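/- Let R = k[x_1,…,x_n] be a standard graded polynomial ring over an infinite field, and let M ≠ 0 be a finitely generated ℤ-graded R-module. Then: (1) Edepth(M) = Edepth(M/H^0_m(M)); (2) if Edepth(M) > 0 and ℓ is a homogeneous element which is strictly filter regular for M, then either Edepth(M/(H^0_m(M) + ℓM)) = Edepth(M) = n, or Edepth(M/(H^0_m(M) + ℓM)) = Edepth(M) − 1. -/

import Mathlib

open CategoryTheory

noncomputable section

/-- The (Krull) dimension of a module: the Krull dimension of its support.
The dimension of the zero module is `⊥` (thought of as `-1`). -/
noncomputable def mDim (R : Type) [CommRing R] (M : Type) [AddCommGroup M] [Module R M] :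
    WithBot ℕ∞ :=
  Order.krullDim (Module.support R M)

/-- The `i`-th Ext module `Ext_R^i(A, B)` (as a type). -/
noncomputable abbrev extC (R : Type) [CommRing R] (i : ℕ) (A B : Type)
    [AddCommGroup A] [Module R A] [AddCommGroup B] [Module R B] : Type :=
  ↥(((Ext R (ModuleCat R) i).obj (Opposite.op (ModuleCat.of R A))).obj (ModuleCat.of R B))

/-- The depth of a module `M` with respect to an ideal `I`:
the least `i` such that `Ext_R^i(R/I, M) ≠ 0` (and `⊤` if there is no such `i`,
in particular the depth of the zero module is `⊤ = +∞`). -/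
noncomputable def mDepth (R : Type) [CommRing R] (I : Ideal R) (M : Type)
    [AddCommGroup M] [Module R M] : ℕ∞ :=
  sInf {i : ℕ∞ | ∃ j : ℕ, i = j ∧ Nontrivial (extC R j (R ⧸ I) M)}

/-- `M` is a Cohen-Macaulay module (with respect to the (maximal) ideal `I`) if it is
nonzero and its depth equals its dimension. -/
def IsCM (R : Type) [CommRing R] (I : Ideal R) (M : Type) [AddCommGroup M] [Module R M] :
    Prop :=
  Nontrivial M ∧ (mDepth R I M : WithBot ℕ∞) = mDim R M

/-- The subquotient `N'/N` of a module (most meaningful when `N ≤ N'`). -/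
abbrev subQuot (R : Type) [CommRing R] {M : Type} [AddCommGroup M] [Module R M]
    (N N' : Submodule R M) : Type :=
  N' ⧸ (Submodule.comap N'.subtype N)

/-- `F 0 = 0 ⊊ F 1 ⊊ ⋯ ⊊ F r = M` is a sCM filtration: each quotient `F (i+1) / F i`
is Cohen-Macaulay and the dimensions of the quotients are strictly increasing. -/
def IsSCMFil (R : Type) [CommRing R] (I : Ideal R) {M : Type} [AddCommGroup M] [Module R M]
    (r : ℕ) (F : ℕ → Submodule R M) : Prop :=
  F 0 = ⊥ ∧ F r = ⊤ ∧ (∀ i < r, F i < F (i + 1)) ∧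
    (∀ i < r, IsCM R I (subQuot R (F i) (F (i + 1)))) ∧
    (∀ i, i + 1 < r →
      mDim R (subQuot R (F i) (F (i + 1))) < mDim R (subQuot R (F (i + 1)) (F (i + 2))))

/-- `M` is sequentially Cohen-Macaulay if it admits a sCM filtration. -/
def IsSeqCM (R : Type) [CommRing R] (I : Ideal R) (M : Type) [AddCommGroup M] [Module R M] :
    Prop :=
  ∃ (r : ℕ) (F : ℕ → Submodule R M), IsSCMFil R I r F

/-- `δ_c(M)`: the largest submodule of `M` of dimension at most `c`. -/
noncomputable def deltaSub (R : Type) [CommRing R] (M : Type) [AddCommGroup M] [Module R M]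
    (c : ℕ) : Submodule R M :=
  sSup {N : Submodule R M | mDim R ↥N ≤ (c : WithBot ℕ∞)}

/-- `δ_{c-1}(M)`, with `δ_{-1}(M) = 0`. -/
noncomputable def deltaSubPred (R : Type) [CommRing R] (M : Type) [AddCommGroup M] [Module R M] :
    ℕ → Submodule R M
  | 0 => ⊥
  | (c + 1) => deltaSub R M c

/-- `H^0_I(M)`, the `I`-power-torsion submodule of `M`. -/
noncomputable def tors (R : Type) [CommRing R] (I : Ideal R) (M : Type) [AddCommGroup M]
    [Module R M] : Submodule R M :=
  ⨆ t : ℕ, Submodule.torsionBySet R M ((I ^ t : Ideal R) : Set R)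

end
noncomputable section

/-- The homogeneous maximal (irrelevant) ideal `𝔪 = (x_1, …, x_n)` of `k[x_1, …, x_n]`. -/
noncomputable def irrIdeal (k : Type) [Field k] (n : ℕ) : Ideal (MvPolynomial (Fin n) k) :=
  Ideal.span (Set.range MvPolynomial.X)

/-- The linear form with coefficients `a : Fin n → k`. -/
noncomputable def linForm (k : Type) [Field k] (n : ℕ) (a : Fin n → k) :
    MvPolynomial (Fin n) k :=
  ∑ i : Fin n, MvPolynomial.C (a i) * MvPolynomial.X i

/-- Given a ℤ-graded module `M` over `k[x_1, …, x_n]` with grading `𝒜`, a submodule `N` is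
graded (homogeneous) if it is spanned by its homogeneous elements. -/
def IsGradedSub (k : Type) [Field k] (n : ℕ) (M : Type) [AddCommGroup M]
    [Module (MvPolynomial (Fin n) k) M] [Module k M]
    [IsScalarTower k (MvPolynomial (Fin n) k) M]
    (𝒜 : ℤ → Submodule k M) (N : Submodule (MvPolynomial (Fin n) k) M) : Prop :=
  N.restrictScalars k ≤ ⨆ e : ℤ, (N.restrictScalars k ⊓ 𝒜 e)

/-- `δ_c(M/N)`: the largest graded submodule of `M/N` of dimension at most `c`, encoded as a
submodule of `M` containing `N`. -/
noncomputable def deltaPairG (k : Type) [Field k] (n : ℕ) (M : Type) [AddCommGroup M]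
    [Module (MvPolynomial (Fin n) k) M] [Module k M]
    [IsScalarTower k (MvPolynomial (Fin n) k) M]
    (𝒜 : ℤ → Submodule k M) (N : Submodule (MvPolynomial (Fin n) k) M) (c : ℕ) :
    Submodule (MvPolynomial (Fin n) k) M :=
  sSup {P | N ≤ P ∧ IsGradedSub k n M 𝒜 P ∧
    mDim (MvPolynomial (Fin n) k) (subQuot (MvPolynomial (Fin n) k) N P) ≤ (c : WithBot ℕ∞)}

/-- `δ_{c-1}(M/N)`, with the convention `δ_{-1} = 0` (i.e. `N` as a submodule of `M`). -/
noncomputable def deltaPairGPred (k : Type) [Field k] (n : ℕ) (M : Type) [AddCommGroup M]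
    [Module (MvPolynomial (Fin n) k) M] [Module k M]
    [IsScalarTower k (MvPolynomial (Fin n) k) M]
    (𝒜 : ℤ → Submodule k M) (N : Submodule (MvPolynomial (Fin n) k) M) :
    ℕ → Submodule (MvPolynomial (Fin n) k) M
  | 0 => N
  | (c + 1) => deltaPairG k n M 𝒜 N c

/-- The quotient `M/N` (of the graded module `M` by a graded submodule `N`) is
`i`-partially sequentially Cohen-Macaulay: the quotients `δ_j/δ_{j-1}` of its dimension
filtration (by largest graded submodules of dimension `≤ j`) are zero or Cohen-Macaulay
for all `j ≥ i`. -/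
noncomputable def IsPartiallySCM (k : Type) [Field k] (n : ℕ) (M : Type) [AddCommGroup M]
    [Module (MvPolynomial (Fin n) k) M] [Module k M]
    [IsScalarTower k (MvPolynomial (Fin n) k) M]
    (𝒜 : ℤ → Submodule k M) (N : Submodule (MvPolynomial (Fin n) k) M) (i : ℕ) : Prop :=
  ∀ j : ℕ, i ≤ j →
    Subsingleton (subQuot (MvPolynomial (Fin n) k)
      (deltaPairGPred k n M 𝒜 N j) (deltaPairG k n M 𝒜 N j)) ∨
    IsCM (MvPolynomial (Fin n) k) (irrIdeal k n)
      (subQuot (MvPolynomial (Fin n) k)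
        (deltaPairGPred k n M 𝒜 N j) (deltaPairG k n M 𝒜 N j))

end
noncomputable section
/-- The `j`-th local cohomology module `H^j_𝔪(A)` of a module `A` over `k[x_1, …, x_n]`,
with support in the homogeneous maximal ideal `𝔪`, as a type. -/
noncomputable abbrev locCoh (k : Type) [Field k] (n : ℕ) (j : ℕ) (A : Type) [AddCommGroup A]
    [Module (MvPolynomial (Fin n) k) A] : Type :=
  ↥((localCohomology (irrIdeal k n) j).obj (ModuleCat.of (MvPolynomial (Fin n) k) A))
end
noncomputable section

/-- Condition `(E_r)` for a module `M` over `R = k[x_1, …, x_n]`: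
`depth (Ext^i_R(M, R)) ≥ min {r, n - i}` for all `i` (depths taken with respect to the
homogeneous maximal ideal; the depth of the zero module is `⊤ = +∞`). -/
def satE (k : Type) [Field k] (n : ℕ) (M : Type) [AddCommGroup M]
    [Module (MvPolynomial (Fin n) k) M] (r : ℕ) : Prop :=
  ∀ i : ℕ, min (r : ℕ∞) ((n : ℕ∞) - (i : ℕ∞)) ≤
    mDepth (MvPolynomial (Fin n) k) (irrIdeal k n)
      (extC (MvPolynomial (Fin n) k) i M (MvPolynomial (Fin n) k))

/-- `Edepth(M) = min {n, sup {r ∈ ℕ | M satisfies (E_r)}}`. -/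
noncomputable def eDepth (k : Type) [Field k] (n : ℕ) (M : Type) [AddCommGroup M]
    [Module (MvPolynomial (Fin n) k) M] : ℕ∞ :=
  min (n : ℕ∞) (sSup {r : ℕ∞ | ∃ m : ℕ, r = (m : ℕ∞) ∧ satE k n M m})

/-- `x` is a strictly filter regular element for `M`: `0 ≠ x ∈ 𝔪` lies outside every
associated prime different from `𝔪` of `X(M) = ⊕_{i ∈ ℕ} Ext^i_R(M, R)` (equivalently,
of each `Ext^i_R(M, R)`). -/
def IsSFRg (k : Type) [Field k] (n : ℕ) (x : MvPolynomial (Fin n) k) (M : Type)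
    [AddCommGroup M] [Module (MvPolynomial (Fin n) k) M] : Prop :=
  x ≠ 0 ∧ x ∈ irrIdeal k n ∧
    ∀ i : ℕ, ∀ p ∈ associatedPrimes (MvPolynomial (Fin n) k)
      (extC (MvPolynomial (Fin n) k) i M (MvPolynomial (Fin n) k)),
      p ≠ irrIdeal k n → x ∉ p

end

section ExtCompare
variable {R : Type} [CommRing R]

/-- The derived-category version of the `Ext` modules. -/
noncomputable abbrev EX (R : Type) [CommRing R] (i : ℕ) (A B : Type) [AddCommGroup A] [Module R A]
    [AddCommGroup B] [Module R B] : Type :=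
  Abelian.Ext.{0} (ModuleCat.of R A) (ModuleCat.of R B) i

open CategoryTheory.ProjectiveResolution CochainComplex.HomComplex

theorem extMk_zero_inj {X Y : ModuleCat.{0} R} (P : ProjectiveResolution X)
    (f : P.complex.X 0 ⟶ Y) (m : ℕ) (hm : 0 + 1 = m) (hf : P.complex.d m 0 ≫ f = 0) 
    (h : P.extMk f m hm hf = 0) : f = 0 := by
  rw [← P.extEquivCohomologyClass.apply_eq_iff_eq,
    extEquivCohomologyClass_extMk, extEquivCohomologyClass_zero,
    CohomologyClass.mk_eq_zero_iff] at h
  rw [Cocycle.toSingleMk_mem_coboundaries_iff _ _ _ _ _ 1 (by simp)] at h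
  obtain ⟨g, hg⟩ := h
  have : P.cochainComplex.d (-(0:ℕ)) 1 = 0 := by
    apply Limits.IsZero.eq_of_tgt
    exact CochainComplex.isZero_of_isStrictlyLE _ 0 1 (by simp)
  rw [this, Limits.zero_comp] at hg
  rw [← cancel_epi (P.cochainComplexXIso (-(0:ℕ)) 0 rfl).hom, ← hg]
  simp

/-- Compute homology of a short complex of modules from a surjection from the cycles. -/
noncomputable def homologyEquivOfSurj (S : ShortComplex (ModuleCat.{0} R)) (E : Type)
    [AddCommGroup E] [Module R E] (φ : LinearMap.ker S.g.hom →ₗ[R] E)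
    (hs : Function.Surjective φ)
    (hk : LinearMap.ker φ = LinearMap.range S.moduleCatToCycles) : S.homology ≃ₗ[R] E :=
  (S.moduleCatHomologyIso.toLinearEquiv).trans
    ((Submodule.quotEquivOfEq _ _ hk.symm).trans (φ.quotKerEquivOfSurjective hs))

theorem cocycle_prop {X : ModuleCat.{0} R} (P : ProjectiveResolution X)
    (Y : ModuleCat.{0} R) (i : ℕ)
    (f : LinearMap.ker (Linear.leftComp R Y (P.complex.d (i+1) i))) :
    P.complex.d (i+1) i ≫ f.1 = 0 := f.2

/-- The cocycle-to-Ext linear map. -/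
noncomputable def cocycleToExt {X : ModuleCat.{0} R} (P : ProjectiveResolution X)
    (Y : ModuleCat.{0} R) (i : ℕ) :
    LinearMap.ker (Linear.leftComp R Y (P.complex.d (i+1) i)) →ₗ[R] Abelian.Ext.{0} X Y i where
  toFun f := P.extMk f.1 (i+1) rfl (cocycle_prop P Y i f)
  map_add' f g := by
    rw [add_extMk]; rfl
  map_smul' r f := by
    rw [RingHom.id_apply, Abelian.Ext.smul_eq_comp_mk₀, extMk_comp_mk₀]
    congr 1

theorem cocycleToExt_surj {X : ModuleCat.{0} R} (P : ProjectiveResolution X)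
    (Y : ModuleCat.{0} R) (i : ℕ) : Function.Surjective (cocycleToExt P Y i) := by
  intro α
  obtain ⟨f, hf, h⟩ := P.extMk_surjective α (i+1) rfl
  exact ⟨⟨f, hf⟩, h⟩

theorem nonempty_extEquiv (i : ℕ) (X Y : ModuleCat.{0} R) :
    Nonempty (((_root_.Ext R (ModuleCat R) i).obj (Opposite.op X)).obj Y ≃ₗ[R]
      Abelian.Ext.{0} X Y i) := by
  let P := ProjectiveResolution.of X
  let K := P.complex.linearYonedaObj R Y
  let e1 := (P.isoExt (R := R) i Y).toLinearEquiv
  let e2 := (K.homologyIsoSc' ((ComplexShape.up ℕ).prev i) i (i+1) rfl (by simp)).toLinearEquiv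
  suffices h : _ from
    ⟨e1.trans (e2.trans (homologyEquivOfSurj (K.sc' ((ComplexShape.up ℕ).prev i) i (i+1)) (Abelian.Ext.{0} X Y i)
      (cocycleToExt P Y i) (cocycleToExt_surj P Y i) h))⟩
  ext ⟨f, hf⟩
  have key : cocycleToExt P Y i ⟨f, hf⟩ = 0 ↔
     ∃ g : P.complex.X ((ComplexShape.up ℕ).prev i) ⟶ Y, P.complex.d _ _ ≫ g = f := by
    cases i with
    | zero =>
      simp
      constructor
      · intro h
        exact (extMk_zero_inj P f _ rfl hf h).symm
      · intro h
        have : (⟨f, hf⟩ : LinearMap.ker (Linear.leftComp R Y (P.complex.d (0+1) 0))) = 0 := by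
          ext1; exact h.symm
        rw [this, map_zero]
    | succ j =>
      have : (ComplexShape.up ℕ).prev (j+1) = j := by simp
      rw [this]
      exact P.extMk_eq_zero_iff f (j+1+1) rfl hf j rfl
  refine Iff.trans key ?_
  constructor
  · rintro ⟨g, hg⟩
    exact ⟨g, Subtype.ext hg⟩
  · rintro ⟨g, hg⟩
    exact ⟨g, congrArg Subtype.val hg⟩

/-- Comparison between the two versions of `Ext`. -/
noncomputable def extCEquiv (i : ℕ) (A B : Type) [AddCommGroup A] [Module R A]
    [AddCommGroup B] [Module R B] : extC R i A B ≃ₗ[R] EX R i A B :=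
  (nonempty_extEquiv i (ModuleCat.of R A) (ModuleCat.of R B)).some

end ExtCompare

section GD
open TensorProduct Polynomial

/-- A short exact sequence of modules. -/
abbrev mkS {R : Type} [CommRing R] {A B C : Type} [AddCommGroup A] [Module R A] [AddCommGroup B]
    [Module R B] [AddCommGroup C] [Module R C] (f : A →ₗ[R] B) (g : B →ₗ[R] C)
    (h : Function.Exact f g) : ShortComplex (ModuleCat.{0} R) :=
  ModuleCat.shortComplexOfCompEqZero f g h.linearMap_comp_eq_zero

theorem mkS_shortExact {R : Type} [CommRing R] {A B C : Type} [AddCommGroup A] [Module R A]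
    [AddCommGroup B]
    [Module R B] [AddCommGroup C] [Module R C] (f : A →ₗ[R] B) (g : B →ₗ[R] C)
    (h : Function.Exact f g) (hf : Function.Injective f) (hg : Function.Surjective g) :
    (mkS f g h).ShortExact :=
  ModuleCat.shortComplex_shortExact _ h hf hg

/-- The ring has global dimension at most `d`. -/
def GD (A : Type) [CommRing A] (d : ℕ) : Prop :=
  ∀ M : ModuleCat.{0} A, HasProjectiveDimensionLE M d

theorem GD_equiv {A B : Type} [CommRing A] [CommRing B] (e : A ≃+* B) (d : ℕ) (h : GD A d) :
    GD B d := by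
  intro M
  letI := Module.compHom M (e : A →+* B)
  letI : RingHomInvPair (RingHomClass.toRingHom e) (RingHomClass.toRingHom e.symm) := RingHomInvPair.of_ringEquiv e
  letI : RingHomInvPair (RingHomClass.toRingHom e.symm) (RingHomClass.toRingHom e) := RingHomInvPair.of_ringEquiv e.symm
  have := h (ModuleCat.of A M)
  let e' : (ModuleCat.of A M) ≃ₛₗ[RingHomClass.toRingHom e] M :=
    { AddEquiv.refl M with map_smul' := fun r x => rfl }
  exact ModuleCat.hasProjectiveDimensionLE_of_semiLinearEquiv e e' d

theorem pd_baseChange {A B : Type} [CommRing A] [CommRing B] [Algebra A B] [Module.Flat A B]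
    (d : ℕ) (M : ModuleCat.{0} A) [HasProjectiveDimensionLE M d] :
    HasProjectiveDimensionLE (ModuleCat.of B (B ⊗[A] M)) d := by
  induction d generalizing M with
  | zero =>
    have projle : HasProjectiveDimensionLE M 0 := ‹_›
    simp only [HasProjectiveDimensionLE, zero_add] at projle ⊢
    rw [← projective_iff_hasProjectiveDimensionLT_one, ← IsProjective.iff_projective] at projle ⊢
    infer_instance
  | succ n ih =>
    rcases ModuleCat.enoughProjectives.1 M with ⟨⟨P, f⟩⟩
    have hf : Function.Surjective f.hom := (ModuleCat.epi_iff_surjective f).1 inferInstance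
    let K := LinearMap.ker f.hom
    have ex : Function.Exact K.subtype f.hom := LinearMap.exact_subtype_ker_map f.hom
    have T_exact := mkS_shortExact K.subtype f.hom ex K.injective_subtype hf
    have ex' : Function.Exact (K.subtype.baseChange B) (f.hom.baseChange B) :=
      lTensor_exact B ex hf
    have TS_exact := mkS_shortExact (K.subtype.baseChange B) (f.hom.baseChange B) ex'
      (Module.Flat.lTensor_preserves_injective_linearMap _ K.injective_subtype)
      (LinearMap.lTensor_surjective B hf)
    have hP : Projective (ModuleCat.of B (B ⊗[A] P)) := by
      have : Projective P := ‹_›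
      rw [← IsProjective.iff_projective] at this ⊢
      infer_instance
    have hP' : Projective (mkS K.subtype f.hom ex).X₂ := by
      have : Projective P := ‹_›
      exact this
    have := (T_exact.hasProjectiveDimensionLT_X₃_iff n hP').mp ‹_›
    exact (TS_exact.hasProjectiveDimensionLT_X₃_iff n hP).mpr (ih (ModuleCat.of A K))

section
variable {A M : Type} [CommRing A] [AddCommGroup M] [Module A M] [Module A[X] M]
  [IsScalarTower A A[X] M]

/-- multiplication by `X` -/
noncomputable def mulX (A M : Type) [CommRing A] [AddCommGroup M] [Module A M] [Module A[X] M]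
  [IsScalarTower A A[X] M] : M →ₗ[A] M := (LinearMap.lsmul A[X] M X).restrictScalars A

/-- The map `X ⊗ 1 - 1 ⊗ X`. -/
noncomputable def phiX (A M : Type) [CommRing A] [AddCommGroup M] [Module A M] [Module A[X] M]
  [IsScalarTower A A[X] M] : A[X] ⊗[A] M →ₗ[A[X]] A[X] ⊗[A] M :=
  (X : A[X]) • (LinearMap.id : A[X] ⊗[A] M →ₗ[A[X]] A[X] ⊗[A] M) - (mulX A M).baseChange A[X]

/-- The action map. -/
noncomputable def psiX (A M : Type) [CommRing A] [AddCommGroup M] [Module A M] [Module A[X] M]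
  [IsScalarTower A A[X] M] : A[X] ⊗[A] M →ₗ[A[X]] M :=
  LinearMap.liftBaseChange A[X] (LinearMap.id)

theorem psi_tmul (p : A[X]) (m : M) : psiX A M (p ⊗ₜ m) = p • m := by
  simp [psiX]

theorem phi_tmul (p : A[X]) (m : M) :
    phiX A M (p ⊗ₜ m) = (X * p) ⊗ₜ m - p ⊗ₜ ((X : A[X]) • m) := by
  simp [phiX, mulX, smul_tmul']

theorem psi_surj : Function.Surjective (psiX A M) := fun m => ⟨1 ⊗ₜ m, by simp [psi_tmul]⟩

theorem phi_psi_exact : Function.Exact (phiX A M) (psiX A M) := by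
  have h1 : ∀ x, psiX A M (phiX A M x) = 0 := by
    intro x
    induction x with
    | zero => simp
    | add x y hx hy => simp [hx, hy]
    | tmul p m => simp [phi_tmul, psi_tmul, mul_smul, smul_comm X p m]
  have h3 : ∀ (n : ℕ) (m : M), (X ^ n : A[X]) ⊗ₜ[A] m - (1 : A[X]) ⊗ₜ[A] ((X ^ n : A[X]) • m) ∈ LinearMap.range (phiX A M) := by
    intro n
    induction n with
    | zero => intro m; simp
    | succ n ih =>
      intro m
      have := Submodule.add_mem _ (LinearMap.mem_range_self (phiX A M) ((X^n) ⊗ₜ m)) (ih ((X : A[X]) • m))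
      rw [phi_tmul] at this
      convert this using 1
      rw [pow_succ', smul_smul, ← pow_succ]
      rw [← pow_succ', sub_add_sub_cancel]
  have h2 : ∀ x, x - 1 ⊗ₜ (psiX A M x) ∈ LinearMap.range (phiX A M) := by
    intro x
    induction x with
    | zero => simp
    | add x y hx hy =>
      have := Submodule.add_mem _ hx hy
      rw [map_add, tmul_add]
      convert this using 1
      abel
    | tmul p m =>
      induction p using Polynomial.induction_on' with
      | add p q hp hq =>
        have := Submodule.add_mem _ hp hq
        rw [add_tmul, map_add, tmul_add]
        convert this using 1
        abel
      | monomial n a =>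
        have := h3 n (a • m)
        convert this using 1
        rw [psi_tmul, ← Polynomial.smul_X_eq_monomial, smul_tmul, smul_assoc, smul_comm a _ m]
  intro x
  constructor
  · intro hx
    have := h2 x
    rw [hx] at this
    simpa using this
  · rintro ⟨y, rfl⟩
    exact h1 y

theorem phi_inj : Function.Injective (phiX A M) := by
  rw [← LinearMap.ker_eq_bot, LinearMap.ker_eq_bot']
  intro x hx
  let e := TensorProduct.equivFinsuppOfBasisLeft (R := A) (N := M) (Polynomial.basisMonomials A)
  have key : ∀ x n, e (phiX A M x) (n+1) = e x n - (X : A[X]) • e x (n+1) := by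
    intro x n
    induction x with
    | zero => simp
    | add x y hx hy => simp only [map_add, Finsupp.add_apply, hx, hy, smul_add]; abel
    | tmul p m =>
      rw [phi_tmul, map_sub]
      simp only [e, Finsupp.sub_apply, TensorProduct.equivFinsuppOfBasisLeft_apply_tmul_apply]
      have hh : ∀ (p : A[X]) n, (Polynomial.basisMonomials A).repr p n = p.coeff n := fun _ _ => rfl
      simp only [hh, coeff_X_mul]
      rw [smul_comm (X : A[X])]
  have key' : ∀ n, e x n = (X : A[X]) • e x (n+1) := by
    intro n
    have := key x n
    rw [hx] at this
    rw [map_zero, Finsupp.zero_apply] at this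
    exact sub_eq_zero.1 this.symm
  have hz : ∃ N, ∀ n, N ≤ n → e x n = 0 := by
    obtain ⟨N, hN⟩ := (e x).support.bddAbove
    refine ⟨N+1, fun n hn => ?_⟩
    by_contra h
    have := hN (Finsupp.mem_support_iff.2 h)
    omega
  obtain ⟨N, hN⟩ := hz
  have h0 : ∀ j n, N ≤ n + j → e x n = 0 := by
    intro j
    induction j with
    | zero => intro n hn; exact hN n hn
    | succ j ih => intro n hn; rw [key', ih (n+1) (by omega), smul_zero]
  apply e.injective
  rw [map_zero]
  ext n
  exact h0 N n (by omega)

end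

theorem GD_poly {A : Type} [CommRing A] (d : ℕ) (h : GD A d) : GD A[X] (d+1) := by
  intro M
  letI : Module A M := Module.compHom M (algebraMap A A[X])
  haveI : IsScalarTower A A[X] M := IsScalarTower.of_algebraMap_smul (fun _ _ => rfl)
  have S := mkS_shortExact (phiX A M) (psiX A M) phi_psi_exact phi_inj psi_surj
  have h0 := h (ModuleCat.of A M)
  have h1 : HasProjectiveDimensionLE (ModuleCat.of A[X] (A[X] ⊗[A] M)) d := pd_baseChange d (ModuleCat.of A M)
  exact S.hasProjectiveDimensionLT_X₃ (d+1) h1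
    (hasProjectiveDimensionLT_of_ge _ (d+1) (d+2) (by omega))

theorem GD_field (K : Type) [Field K] : GD K 0 := by
  intro M
  rw [← projective_iff_hasProjectiveDimensionLE_zero, ← IsProjective.iff_projective]
  exact Module.Projective.of_free

theorem GD_fin (K : Type) [Field K] (m : ℕ) : GD (MvPolynomial (Fin m) K) m := by
  induction m with
  | zero => exact GD_equiv (MvPolynomial.isEmptyRingEquiv K (Fin 0)).symm 0 (GD_field K)
  | succ m ih => exact GD_equiv (MvPolynomial.finSuccEquiv K m).symm.toRingEquiv _ (GD_poly m ih)

theorem GD_mv (K σ : Type) [Field K] [Fintype σ] : GD (MvPolynomial σ K) (Fintype.card σ) :=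
  GD_equiv (MvPolynomial.renameEquiv K (Fintype.equivFin σ)).symm.toRingEquiv _ (GD_fin K _)

end GD

section ExtTools
open CategoryTheory.Abelian
variable {R : Type} [CommRing R]
variable {A B C X Y : Type} [AddCommGroup A] [Module R A] [AddCommGroup B] [Module R B]
  [AddCommGroup C] [Module R C] [AddCommGroup X] [Module R X] [AddCommGroup Y] [Module R Y]

/-- covariant functoriality of `Ext` -/
noncomputable def exPost (i : ℕ) (X : Type) [AddCommGroup X] [Module R X] (f : A →ₗ[R] B) :
    EX R i X A →ₗ[R] EX R i X B where
  toFun x := x.comp (Ext.mk₀ (ModuleCat.ofHom f)) (add_zero i)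
  map_add' x y := by simp
  map_smul' r x := by simp

/-- contravariant functoriality of `Ext` -/
noncomputable def exPre (i : ℕ) (Y : Type) [AddCommGroup Y] [Module R Y] (f : A →ₗ[R] B) :
    EX R i B Y →ₗ[R] EX R i A Y where
  toFun x := (Ext.mk₀ (ModuleCat.ofHom f)).comp x (zero_add i)
  map_add' x y := by simp
  map_smul' r x := by simp

/-- covariant connecting map -/
noncomputable def exDel (i : ℕ) (X : Type) [AddCommGroup X] [Module R X]
    {f : A →ₗ[R] B} {g : B →ₗ[R] C} {h : Function.Exact f g} (hS : (mkS f g h).ShortExact) :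
    EX R i X C →ₗ[R] EX R (i+1) X A where
  toFun x := x.comp hS.extClass rfl
  map_add' x y := by simp
  map_smul' r x := by simp

/-- contravariant connecting map -/
noncomputable def exDel' (i : ℕ) (Y : Type) [AddCommGroup Y] [Module R Y]
    {f : A →ₗ[R] B} {g : B →ₗ[R] C} {h : Function.Exact f g} (hS : (mkS f g h).ShortExact) :
    EX R i A Y →ₗ[R] EX R (i+1) C Y where
  toFun x := hS.extClass.comp x (add_comm 1 i)
  map_add' x y := by simp
  map_smul' r x := by simp

theorem exPost_comp (i : ℕ) (X : Type) [AddCommGroup X] [Module R X] (f : A →ₗ[R] B)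
    (g : B →ₗ[R] C) (x : EX R i X A) : exPost i X g (exPost i X f x) = exPost i X (g ∘ₗ f) x := by
  simp only [exPost, LinearMap.coe_mk, AddHom.coe_mk, Ext.comp_assoc_of_third_deg_zero,
    Ext.mk₀_comp_mk₀, ModuleCat.ofHom_comp]

theorem exPre_comp (i : ℕ) (Y : Type) [AddCommGroup Y] [Module R Y] (f : A →ₗ[R] B)
    (g : B →ₗ[R] C) (x : EX R i C Y) : exPre i Y f (exPre i Y g x) = exPre i Y (g ∘ₗ f) x := by
  simp only [exPre, LinearMap.coe_mk, AddHom.coe_mk, 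
    Ext.mk₀_comp_mk₀_assoc, ModuleCat.ofHom_comp]

theorem exPost_id (i : ℕ) (x : EX R i X A) :
    exPost i X (LinearMap.id : A →ₗ[R] A) x = x := by
  simp [exPost]

theorem exPre_id (i : ℕ) (x : EX R i A Y) :
    exPre i Y (LinearMap.id : A →ₗ[R] A) x = x := by
  simp [exPre]

theorem exPost_add (i : ℕ) (f g : A →ₗ[R] B) (x : EX R i X A) :
    exPost i X (f + g) x = exPost i X f x + exPost i X g x := by
  simp [exPost, ModuleCat.ofHom_add, Ext.mk₀_add]

theorem exPre_add (i : ℕ) (f g : A →ₗ[R] B) (x : EX R i B Y) :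
    exPre i Y (f + g) x = exPre i Y f x + exPre i Y g x := by
  simp [exPre, ModuleCat.ofHom_add, Ext.mk₀_add]

theorem exPost_smul (i : ℕ) (r : R) (f : A →ₗ[R] B) (x : EX R i X A) :
    exPost i X (r • f) x = r • exPost i X f x := by
  have : ModuleCat.ofHom (r • f) = r • ModuleCat.ofHom f := rfl
  simp [exPost, this, Ext.mk₀_smul]

theorem exPre_smul (i : ℕ) (r : R) (f : A →ₗ[R] B) (x : EX R i B Y) :
    exPre i Y (r • f) x = r • exPre i Y f x := by
  have : ModuleCat.ofHom (r • f) = r • ModuleCat.ofHom f := rfl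
  simp [exPre, this, Ext.mk₀_smul]

theorem exPost_sum {ι : Type} (s : Finset ι) (i : ℕ) (f : ι → A →ₗ[R] B) (x : EX R i X A) :
    exPost i X (∑ j ∈ s, f j) x = ∑ j ∈ s, exPost i X (f j) x := by
  classical
  induction s using Finset.induction_on with
  | empty =>
    have := exPost_smul i (0 : R) (0 : A →ₗ[R] B) x
    simpa using this
  | insert a s ha ih => rw [Finset.sum_insert ha, Finset.sum_insert ha, exPost_add, ih]

theorem exPre_bij (i : ℕ) (e : A ≃ₗ[R] B) : Function.Bijective (exPre i Y e.toLinearMap) := by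
  rw [Function.bijective_iff_has_inverse]
  refine ⟨exPre i Y e.symm.toLinearMap, fun x => ?_, fun x => ?_⟩
  · rw [exPre_comp]; simp [exPre_id]
  · rw [exPre_comp]; simp [exPre_id]

theorem exPost_bij (i : ℕ) (e : A ≃ₗ[R] B) : Function.Bijective (exPost i X e.toLinearMap) := by
  rw [Function.bijective_iff_has_inverse]
  refine ⟨exPost i X e.symm.toLinearMap, fun x => ?_, fun x => ?_⟩
  · rw [exPost_comp]; simp [exPost_id]
  · rw [exPost_comp]; simp [exPost_id]

section LES
theorem les_aux3 {S : ShortComplex (ModuleCat.{0} R)} (hS : S.ShortExact) {Z : ModuleCat.{0} R}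
    {i : ℕ} (y : Ext.{0} Z S.X₂ i) :
    (y.comp (Ext.mk₀ S.g) (add_zero i)).comp hS.extClass rfl = 0 := by
  simp [Ext.comp_assoc_of_second_deg_zero]

theorem les_aux1 {S : ShortComplex (ModuleCat.{0} R)} (hS : S.ShortExact) {Z : ModuleCat.{0} R}
    {i : ℕ} (y : Ext.{0} Z S.X₃ i) :
    (y.comp hS.extClass rfl).comp (Ext.mk₀ S.f) (add_zero (i+1)) = 0 := by
  simp [Ext.comp_assoc_of_third_deg_zero]

theorem les_aux1' {S : ShortComplex (ModuleCat.{0} R)} (hS : S.ShortExact) {Z : ModuleCat.{0} R}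
    {i : ℕ} (y : Ext.{0} S.X₂ Z i) :
    hS.extClass.comp ((Ext.mk₀ S.f).comp y (zero_add i)) (add_comm 1 i) = 0 := by
  simp

theorem les_aux3' {S : ShortComplex (ModuleCat.{0} R)} (hS : S.ShortExact) {Z : ModuleCat.{0} R}
    {i : ℕ} (y : Ext.{0} S.X₁ Z i) :
    (Ext.mk₀ S.g).comp (hS.extClass.comp y (add_comm 1 i)) (zero_add (i+1)) = 0 := by
  simp

variable {f : A →ₗ[R] B} {g : B →ₗ[R] C} {h : Function.Exact f g} (hS : (mkS f g h).ShortExact)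

theorem les_post₂ (hS : (mkS f g h).ShortExact) (i : ℕ) : Function.Exact (exPost i X f) (exPost i X g) := by
  intro x
  constructor
  · intro hx
    exact Ext.covariant_sequence_exact₂ _ hS x hx
  · rintro ⟨y, rfl⟩
    rw [exPost_comp, h.linearMap_comp_eq_zero]
    simpa using exPost_smul i (0 : R) (0 : A →ₗ[R] C) y

theorem les_post₃ (i : ℕ) : Function.Exact (exPost i X g) (exDel i X hS) := by
  intro x
  constructor
  · intro hx
    exact Ext.covariant_sequence_exact₃ _ hS x rfl hx
  · rintro ⟨y, rfl⟩
    change (y.comp (Ext.mk₀ (mkS f g h).g) (add_zero i)).comp hS.extClass rfl = 0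
    exact les_aux3 hS y

theorem les_post₁ (i : ℕ) : Function.Exact (exDel i X hS) (exPost (i+1) X f) := by
  intro x
  constructor
  · intro hx
    exact Ext.covariant_sequence_exact₁ _ hS x hx rfl
  · rintro ⟨y, rfl⟩
    change (y.comp hS.extClass rfl).comp (Ext.mk₀ (mkS f g h).f) (add_zero _) = 0
    exact les_aux1 hS y

theorem les_pre₂ (hS : (mkS f g h).ShortExact) (i : ℕ) : Function.Exact (exPre i Y g) (exPre i Y f) := by
  intro x
  constructor
  · intro hx
    exact Ext.contravariant_sequence_exact₂ hS _ x hx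
  · rintro ⟨y, rfl⟩
    rw [exPre_comp, h.linearMap_comp_eq_zero]
    simpa using exPre_smul i (0 : R) (0 : A →ₗ[R] C) y

theorem les_pre₁ (i : ℕ) : Function.Exact (exPre i Y f) (exDel' i Y hS) := by
  intro x
  constructor
  · intro hx
    exact Ext.contravariant_sequence_exact₁ hS _ x (add_comm 1 i) hx
  · rintro ⟨y, rfl⟩
    change hS.extClass.comp ((Ext.mk₀ (mkS f g h).f).comp y (zero_add i)) (add_comm 1 i) = 0
    exact les_aux1' hS y

theorem les_pre₃ (i : ℕ) : Function.Exact (exDel' i Y hS) (exPre (i+1) Y g) := by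
  intro x
  constructor
  · intro hx
    exact Ext.contravariant_sequence_exact₃ hS _ x hx (add_comm 1 i)
  · rintro ⟨y, rfl⟩
    change (Ext.mk₀ (mkS f g h).g).comp (hS.extClass.comp y (add_comm 1 i)) (zero_add _) = 0
    exact les_aux3' hS y

end LES

/-- degree zero -/
noncomputable def ex0 (A B : Type) [AddCommGroup A] [Module R A] [AddCommGroup B] [Module R B] :
    (A →ₗ[R] B) →ₗ[R] EX R 0 A B where
  toFun f := Ext.mk₀ (ModuleCat.ofHom f)
  map_add' f g := by simp [ModuleCat.ofHom_add, Ext.mk₀_add]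
  map_smul' r f := by
    have : ModuleCat.ofHom (r • f) = r • ModuleCat.ofHom f := rfl
    simp [this, Ext.mk₀_smul]

theorem ex0_bij : Function.Bijective (ex0 (R := R) A B) := by
  refine ⟨fun f g hfg => ?_, fun x => ?_⟩
  · have := (Ext.mk₀_bijective _ _).1 hfg
    exact congrArg ModuleCat.Hom.hom this
  · obtain ⟨f, hf⟩ := (Ext.mk₀_bijective _ _).2 x
    exact ⟨f.hom, hf⟩

theorem ex0_post (f : A →ₗ[R] B) (x : X →ₗ[R] A) :
    exPost 0 X f (ex0 _ _ x) = ex0 _ _ (f ∘ₗ x) := by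
  simp [exPost, ex0, Ext.mk₀_comp_mk₀]

theorem ex0_pre (f : A →ₗ[R] B) (x : B →ₗ[R] Y) :
    exPre 0 Y f (ex0 _ _ x) = ex0 _ _ (x ∘ₗ f) := by
  simp [exPre, ex0, Ext.mk₀_comp_mk₀]

theorem exPost_inj0 (f : A →ₗ[R] B) (hf : Function.Injective f) :
    Function.Injective (exPost 0 X f) := by
  intro x y hxy
  obtain ⟨x, rfl⟩ := ex0_bij.2 x
  obtain ⟨y, rfl⟩ := ex0_bij.2 y
  rw [ex0_post, ex0_post] at hxy
  have := ex0_bij.1 hxy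
  congr 1
  exact LinearMap.cancel_left hf |>.1 this

theorem exPre_inj0 (f : A →ₗ[R] B) (hf : Function.Surjective f) :
    Function.Injective (exPre 0 Y f) := by
  intro x y hxy
  obtain ⟨x, rfl⟩ := ex0_bij.2 x
  obtain ⟨y, rfl⟩ := ex0_bij.2 y
  rw [ex0_pre, ex0_pre] at hxy
  have := ex0_bij.1 hxy
  congr 1
  exact LinearMap.cancel_right hf |>.1 this

theorem ex_zero_of_projective [Module.Projective R A] (i : ℕ) (x : EX R (i+1) A B) : x = 0 := by
  have : Projective (ModuleCat.of R A) := (IsProjective.iff_projective A).1 ‹_›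
  exact Ext.eq_zero_of_projective x

/-- killed by an element of `S` -/
def SK (S : Submonoid R) (X : Type) [AddCommGroup X] [Module R X] : Prop :=
  ∃ s ∈ S, ∀ x : X, s • x = 0

theorem SK.mid {S : Submonoid R} {f : A →ₗ[R] B} {g : B →ₗ[R] C} (h : Function.Exact f g)
    (hA : SK S A) (hC : SK S C) : SK S B := by
  obtain ⟨s, hs, hA⟩ := hA
  obtain ⟨t, ht, hC⟩ := hC
  refine ⟨s * t, S.mul_mem hs ht, fun x => ?_⟩
  have : g (t • x) = 0 := by rw [map_smul, hC]
  obtain ⟨y, hy⟩ := (h _).1 this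
  rw [mul_smul, ← hy, ← map_smul, hA, map_zero]

theorem SK.inj {S : Submonoid R} {f : A →ₗ[R] B} (h : Function.Injective f)
    (hB : SK S B) : SK S A := by
  obtain ⟨s, hs, hB⟩ := hB
  exact ⟨s, hs, fun x => h (by rw [map_smul, hB, map_zero])⟩

theorem SK.surj {S : Submonoid R} {f : A →ₗ[R] B} (h : Function.Surjective f)
    (hB : SK S A) : SK S B := by
  obtain ⟨s, hs, hB⟩ := hB
  refine ⟨s, hs, fun x => ?_⟩
  obtain ⟨y, rfl⟩ := h x
  rw [← map_smul, hB, map_zero]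

theorem SK.of_subsingleton {S : Submonoid R} (h : ∀ x : A, x = 0) : SK S A :=
  ⟨1, S.one_mem, fun x => by rw [h x, smul_zero]⟩

theorem ex_smul_of_left (r : R) (h : ∀ a : A, r • a = 0) (i : ℕ) (x : EX R i A B) : r • x = 0 := by
  have : r • (LinearMap.id : A →ₗ[R] A) = (0 : R) • LinearMap.id := by ext a; simp [h]
  have h2 := exPre_smul i r (LinearMap.id : A →ₗ[R] A) x
  rw [this, exPre_smul, exPre_id, zero_smul] at h2
  exact h2.symm

theorem ex_smul_of_right (r : R) (h : ∀ a : B, r • a = 0) (i : ℕ) (x : EX R i A B) : r • x = 0 := by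
  have : r • (LinearMap.id : B →ₗ[R] B) = (0 : R) • LinearMap.id := by ext a; simp [h]
  have h2 := exPost_smul i r (LinearMap.id : B →ₗ[R] B) x
  rw [this, exPost_smul, exPost_id, zero_smul] at h2
  exact h2.symm

theorem SK.pi {S : Submonoid R} (i m : ℕ) (h : SK S (EX R i X A)) :
    SK S (EX R i X (Fin m → A)) := by
  obtain ⟨s, hs, h⟩ := h
  refine ⟨s, hs, fun x => ?_⟩
  have hid : (LinearMap.id : (Fin m → A) →ₗ[R] (Fin m → A)) =
      ∑ j : Fin m, LinearMap.single R (fun _ => A) j ∘ₗ LinearMap.proj j := by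
    ext
    simp
  rw [← exPost_id i x, hid, exPost_sum, Finset.smul_sum]
  refine Finset.sum_eq_zero fun j _ => ?_
  rw [← exPost_comp, ← map_smul, h, map_zero]

end ExtTools

section LemT
variable {R : Type} [CommRing R] [IsNoetherianRing R] (S : Submonoid R)

/-- Localization of a linear map. -/
noncomputable def locMap {A B : Type} [AddCommGroup A] [Module R A] [AddCommGroup B] [Module R B]
    (f : A →ₗ[R] B) : LocalizedModule S A →ₗ[Localization S] LocalizedModule S B :=
  (IsLocalizedModule.map S (LocalizedModule.mkLinearMap S A)
    (LocalizedModule.mkLinearMap S B) f).extendScalarsOfIsLocalization S (Localization S)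

theorem lemT_zero (M N : Type) [AddCommGroup M] [Module R M] [Module.Finite R M] [AddCommGroup N]
    [Module R N] [Module.Projective (Localization S) (LocalizedModule S M)] (i : ℕ) :
    SK S (EX R (i+1) M N) := by
  obtain ⟨k, π, hπ⟩ := Module.Finite.exists_fin' R M
  have hs : Function.Surjective (locMap S π) := IsLocalizedModule.map_surjective S
    (LocalizedModule.mkLinearMap S _) (LocalizedModule.mkLinearMap S _) π hπ
  obtain ⟨τ, hτ⟩ := Module.projective_lifting_property (locMap S π) LinearMap.id hs
  have : Module.FinitePresentation R M := Module.finitePresentation_of_finite R M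
  obtain ⟨σ, s, hσ⟩ := Module.FinitePresentation.exists_lift_of_isLocalizedModule S
    (LocalizedModule.mkLinearMap S (Fin k → R))
    ((τ.restrictScalars R) ∘ₗ LocalizedModule.mkLinearMap S M)
  have h1 : (LocalizedModule.mkLinearMap S M).comp (π ∘ₗ σ) =
      (LocalizedModule.mkLinearMap S M).comp (s • LinearMap.id) := by
    ext m
    have a1 : ∀ v, LocalizedModule.mkLinearMap S M (π v) =
        locMap S π (LocalizedModule.mkLinearMap S (Fin k → R) v) := fun v =>
      (IsLocalizedModule.map_apply S (LocalizedModule.mkLinearMap S _)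
        (LocalizedModule.mkLinearMap S _) π v).symm
    have a2 := LinearMap.congr_fun hσ m
    simp only [LinearMap.comp_apply, LinearMap.smul_apply, LinearMap.restrictScalars_apply] at a2 ⊢
    rw [a1, a2, LinearMap.map_smul_of_tower]
    have a3 := LinearMap.congr_fun hτ (LocalizedModule.mkLinearMap S M m)
    simp only [LinearMap.comp_apply, LinearMap.id_apply] at a3 ⊢
    rw [a3, LinearMap.map_smul_of_tower]
  obtain ⟨t, ht⟩ := Module.Finite.exists_smul_of_comp_eq_of_isLocalizedModule S
    (LocalizedModule.mkLinearMap S M) _ _ h1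
  refine ⟨t * s, S.mul_mem t.2 s.2, fun x => ?_⟩
  have h2 : (t : R) • (π ∘ₗ σ) = ((t : R) * s) • (LinearMap.id : M →ₗ[R] M) := by
    rw [mul_smul]; exact ht
  have := exPre_smul (i+1) ((t : R) * s) (LinearMap.id : M →ₗ[R] M) x
  rw [exPre_id, ← h2, exPre_smul, ← exPre_comp, ex_zero_of_projective i (exPre (i+1) N π x),
    map_zero, smul_zero] at this
  exact this.symm

theorem lemT_aux (m : ℕ) : ∀ (M N : Type) [AddCommGroup M] [Module R M] [Module.Finite R M]
    [AddCommGroup N] [Module R N]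
    (_ : HasProjectiveDimensionLE (ModuleCat.of (Localization S) (LocalizedModule S M)) m) (i : ℕ)
    (_ : m < i), SK S (EX R i M N) := by
  induction m with
  | zero =>
    intro M N _ _ _ _ _ h i hi
    rw [← projective_iff_hasProjectiveDimensionLE_zero, ← IsProjective.iff_projective] at h
    obtain ⟨j, rfl⟩ := Nat.exists_eq_succ_of_ne_zero (by omega : i ≠ 0)
    exact lemT_zero S M N j
  | succ m ih =>
    intro M N _ _ _ _ _ h i hi
    obtain ⟨j, rfl⟩ := Nat.exists_eq_succ_of_ne_zero (by omega : i ≠ 0)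
    obtain ⟨k, π, hπ⟩ := Module.Finite.exists_fin' R M
    let K := LinearMap.ker π
    have ex : Function.Exact K.subtype π := LinearMap.exact_subtype_ker_map π
    have hS := mkS_shortExact K.subtype π ex K.injective_subtype hπ
    have ex' : Function.Exact (locMap S K.subtype) (locMap S π) :=
      IsLocalizedModule.map_exact S _ _ _ _ _ ex
    have hS' := mkS_shortExact (locMap S K.subtype) (locMap S π) ex'
      (IsLocalizedModule.map_injective S _ _ _ K.injective_subtype)
      (IsLocalizedModule.map_surjective S _ _ _ hπ)
    have hP : Projective (ModuleCat.of (Localization S) (LocalizedModule S (Fin k → R))) := by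
      rw [← IsProjective.iff_projective]
      exact Module.projective_of_isLocalizedModule S (LocalizedModule.mkLinearMap S (Fin k → R))
    have hK := (hS'.hasProjectiveDimensionLT_X₃_iff m hP).mp h
    have := ih K N hK j (by omega)
    refine SK.surj (f := exDel' j N hS) ?_ this
    intro x
    exact ((les_pre₃ hS j) x).1 (ex_zero_of_projective j _)

theorem lemT (m : ℕ) (hG : GD (Localization S) m) (M N : Type) [AddCommGroup M] [Module R M]
    [Module.Finite R M]
    [AddCommGroup N] [Module R N] (i : ℕ) (hi : m < i) : SK S (EX R i M N) :=
  lemT_aux S m M N (hG _) i hi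

end LemT

section SV
open MvPolynomial

variable {k : Type} [Field k] {σ : Type}

/-- nonzero polynomials in the variables from `T` -/
def SV (k : Type) [Field k] {σ : Type} (T : Set σ) : Submonoid (MvPolynomial σ k) where
  carrier := {f | f ≠ 0 ∧ f ∈ supported k T}
  one_mem' := ⟨one_ne_zero, one_mem _⟩
  mul_mem' := fun ha hb => ⟨mul_ne_zero ha.1 hb.1, mul_mem ha.2 hb.2⟩

theorem mem_SV {T : Set σ} {f : MvPolynomial σ k} : f ∈ SV k T ↔ f ≠ 0 ∧ f ∈ supported k T :=
  Iff.rfl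

theorem SV_mono {T U : Set σ} (h : T ⊆ U) : SV k T ≤ SV k U :=
  fun _ hf => ⟨hf.1, supported_mono h hf.2⟩

/-- splitting the variables -/
noncomputable def splitE (k : Type) [Field k] {σ : Type} (T : Set σ) :
    MvPolynomial σ k ≃ₐ[k] MvPolynomial (Tᶜ : Set σ) (MvPolynomial T k) :=
  haveI := Classical.decPred (· ∈ T)
  (renameEquiv k ((Equiv.Set.sumCompl T).symm.trans (Equiv.sumComm _ _))).trans
    (sumAlgEquiv k _ _)

theorem splitE_rename (T : Set σ) (a : MvPolynomial T k) :
    splitE k T (rename (Subtype.val) a) = C a := by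
  classical
  have : (splitE k T).toAlgHom.comp (rename (Subtype.val : T → σ)) =
      (IsScalarTower.toAlgHom k (MvPolynomial T k) (MvPolynomial (Tᶜ : Set σ) (MvPolynomial T k))) := by
    ext i : 1
    simp [splitE]
  exact DFunLike.congr_fun this a

theorem SV_map (T : Set σ) : (SV k T).map (splitE k T).toRingEquiv.toMonoidHom =
    (nonZeroDivisors (MvPolynomial T k)).map (C : MvPolynomial T k →+* MvPolynomial (Tᶜ : Set σ) (MvPolynomial T k)) := by
  ext x
  constructor
  · rintro ⟨f, ⟨hf0, hf⟩, rfl⟩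
    rw [supported_eq_range_rename] at hf
    obtain ⟨a, rfl⟩ := hf
    refine ⟨a, mem_nonZeroDivisors_of_ne_zero ?_, (splitE_rename T a).symm⟩
    rintro rfl; simp at hf0
  · rintro ⟨a, ha, rfl⟩
    refine ⟨rename Subtype.val a, ⟨?_, ?_⟩, splitE_rename T a⟩
    · intro h
      rw [map_eq_zero_iff _ (rename_injective _ Subtype.val_injective)] at h
      exact nonZeroDivisors.ne_zero ha h
    · rw [supported_eq_range_rename]; exact ⟨a, rfl⟩

attribute [local instance] MvPolynomial.algebraMvPolynomial in
theorem GD_SV [Finite σ] (T : Set σ) : GD (Localization (SV k T)) (Set.ncard Tᶜ) := by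
  classical
  haveI := Fintype.ofFinite σ
  let Q := FractionRing (MvPolynomial T k)
  haveI : IsLocalization ((nonZeroDivisors (MvPolynomial T k)).map (C : MvPolynomial T k →+* MvPolynomial (Tᶜ : Set σ) (MvPolynomial T k))) (MvPolynomial (Tᶜ : Set σ) Q) :=
    MvPolynomial.isLocalization _ _ 
  have e : Localization (SV k T) ≃+* MvPolynomial (Tᶜ : Set σ) Q :=
    IsLocalization.ringEquivOfRingEquiv _ _ (splitE k T).toRingEquiv (SV_map T)
  have := GD_mv Q (Tᶜ : Set σ)
  rw [← Nat.card_eq_fintype_card] at this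
  exact GD_equiv e.symm _ this

theorem lemSV [Finite σ] (T : Set σ)  (M N : Type) [AddCommGroup M] [Module (MvPolynomial σ k) M]
    [Module.Finite (MvPolynomial σ k) M]
    [AddCommGroup N] [Module (MvPolynomial σ k) N] (i : ℕ) (hi : Tᶜ.ncard < i) :
    SK (SV k T) (EX (MvPolynomial σ k) i M N) :=
  lemT _ _ (GD_SV T) M N i hi

end SV

section Alg
open MvPolynomial

variable {k : Type} [Field k] {σ : Type}

theorem mk_rename (q : Ideal (MvPolynomial σ k)) (T : Set σ) (a : MvPolynomial T k) :
    Ideal.Quotient.mkₐ k q (rename Subtype.val a) =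
      aeval (fun i : T => Ideal.Quotient.mkₐ k q (X i)) a := by
  have : (Ideal.Quotient.mkₐ k q).comp (rename (Subtype.val : T → σ)) =
      aeval (fun i : T => Ideal.Quotient.mkₐ k q (X i)) := by
    ext i
    simp
  exact DFunLike.congr_fun this a

theorem indepOn_iff (q : Ideal (MvPolynomial σ k)) (T : Set σ) :
    AlgebraicIndepOn k (fun i => Ideal.Quotient.mkₐ k q (X i)) T ↔ ∀ s ∈ SV k T, s ∉ q := by
  unfold AlgebraicIndepOn AlgebraicIndependent
  rw [injective_iff_map_eq_zero]
  constructor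
  · rintro h s ⟨hs0, hs⟩ hsq
    rw [supported_eq_range_rename] at hs
    obtain ⟨a, rfl⟩ := hs
    have : a = 0 := h a (by
      rw [← mk_rename]
      exact Ideal.Quotient.eq_zero_iff_mem.2 hsq)
    subst this
    exact hs0 (map_zero _)
  · intro h a ha
    by_contra ha0
    rw [← mk_rename] at ha
    refine h (rename Subtype.val a) ⟨?_, ?_⟩ (Ideal.Quotient.eq_zero_iff_mem.1 ha)
    · intro h
      rw [map_eq_zero_iff _ (rename_injective _ Subtype.val_injective)] at h
      exact ha0 h
    · rw [supported_eq_range_rename]; exact ⟨a, rfl⟩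

theorem lemAlg (q : Ideal (MvPolynomial σ k)) [q.IsPrime] (T : Set σ) (hT : ∀ s ∈ SV k T, s ∉ q)
    (hmax : ∀ y ∉ T, ∃ g ∈ SV k (insert y T), g ∈ q) (a : MvPolynomial σ k) (ha : a ∉ q) :
    ∃ s ∈ SV k T, s ∈ q ⊔ Ideal.span {a} := by
  let v : σ → MvPolynomial σ k ⧸ q := fun i => Ideal.Quotient.mkₐ k q (X i)
  let A := Algebra.adjoin k (v '' T)
  have hind : AlgebraicIndepOn k v T := (indepOn_iff q T).2 hT
  have hX : ∀ y, IsAlgebraic A (v y) := by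
    intro y
    by_cases hy : y ∈ T
    · exact isAlgebraic_algebraMap (⟨v y, Algebra.subset_adjoin ⟨y, hy, rfl⟩⟩ : A)
    · by_contra hcon
      obtain ⟨g, hg, hgq⟩ := hmax y hy
      exact (indepOn_iff q _).1 (hind.insert hcon) g hg hgq
  have hall : ∀ f : MvPolynomial σ k, Ideal.Quotient.mkₐ k q f ∈ Subalgebra.algebraicClosure A (MvPolynomial σ k ⧸ q) := by
    intro f
    induction f using MvPolynomial.induction_on with
    | C c =>
      exact isAlgebraic_algebraMap (algebraMap k A c)
    | add f g hf hg => rw [map_add]; exact add_mem hf hg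
    | mul_X f i hf => rw [map_mul]; exact mul_mem hf (hX i)
  have h1 : IsAlgebraic A (Ideal.Quotient.mkₐ k q a) := hall a
  have h0 : Ideal.Quotient.mkₐ k q a ≠ 0 := fun h => ha (Ideal.Quotient.eq_zero_iff_mem.1 h)
  obtain ⟨r, hr0, hr⟩ := h1.exists_nonzero_dvd (mem_nonZeroDivisors_of_ne_zero h0)
  obtain ⟨r, hrA⟩ := r
  have : ∃ b : MvPolynomial T k, Ideal.Quotient.mkₐ k q (rename Subtype.val b) = r := by
    have hA : A = (aeval (R := k) (fun i : T => v i)).range := by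
      rw [← Algebra.adjoin_range_eq_range_aeval]
      exact congrArg (Algebra.adjoin k) (Set.image_eq_range v T)
    have hrA' := hrA
    rw [hA] at hrA'
    obtain ⟨b, hb⟩ := hrA'
    exact ⟨b, (mk_rename q T b).trans hb⟩
  obtain ⟨b, hb⟩ := this
  refine ⟨rename Subtype.val b, ⟨?_, ?_⟩, ?_⟩
  · intro h
    rw [h, map_zero] at hb
    exact hr0 (Subtype.ext hb.symm)
  · rw [supported_eq_range_rename]; exact ⟨b, rfl⟩
  · obtain ⟨c, hc⟩ := hr
    obtain ⟨c, rfl⟩ := Ideal.Quotient.mkₐ_surjective k q c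
    change r = _ at hc
    rw [← hb, ← map_mul] at hc
    have := Ideal.Quotient.eq.1 hc
    rw [Submodule.mem_sup]
    exact ⟨_, this, a * c, Ideal.mul_mem_right _ _ (Ideal.mem_span_singleton_self a), by ring⟩

end Alg

section QR

theorem poly_qr {P : Type} [CommRing P] (J : Ideal P) (F : Polynomial P) (d : ℕ) :
    ∀ G : Polynomial P, G.degree < d → F * G ∈ J.map Polynomial.C →
      Polynomial.C (F.leadingCoeff ^ d) * G ∈ J.map Polynomial.C := by
  induction d with
  | zero =>
    intro G hG _
    have : G = 0 := by
      rw [← Polynomial.degree_eq_bot]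
      exact Nat.WithBot.lt_zero_iff.1 hG
    simp [this]
  | succ d ih =>
    intro G hG hFG
    set s := F.leadingCoeff
    have hGn : G.natDegree ≤ d := by
      by_cases h0 : G = 0
      · simp [h0]
      · have := (Polynomial.natDegree_lt_iff_degree_lt h0).2 hG
        omega
    have h1 : s * G.coeff d ∈ J := by
      have := Ideal.mem_map_C_iff.1 hFG (F.natDegree + d)
      rwa [Polynomial.coeff_mul_add_eq_of_natDegree_le le_rfl hGn] at this
    let G' := Polynomial.C s * G - Polynomial.C (s * G.coeff d) * Polynomial.X ^ d
    have hC : Polynomial.C (s * G.coeff d) * Polynomial.X ^ d ∈ J.map Polynomial.C :=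
      Ideal.mul_mem_right _ _ (Ideal.mem_map_of_mem _ h1)
    have hG' : G'.degree < d := by
      rw [Polynomial.degree_lt_iff_coeff_zero]
      intro m hm
      rcases hm.eq_or_lt with rfl | hm
      · simp [G', Polynomial.coeff_C_mul, -map_mul]
      · simp [G', -map_mul, Polynomial.coeff_C_mul, Polynomial.coeff_X_pow, hm.ne', Polynomial.coeff_eq_zero_of_natDegree_lt (lt_of_le_of_lt hGn hm)]
    have h2 : F * G' ∈ J.map Polynomial.C := by
      have : F * G' = Polynomial.C s * (F * G) - F * (Polynomial.C (s * G.coeff d) * Polynomial.X ^ d) := by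
        simp only [G']; ring
      rw [this]
      exact sub_mem (Ideal.mul_mem_left _ _ hFG) (Ideal.mul_mem_left _ _ hC)
    have h3 := ih G' hG' h2
    have : Polynomial.C (s ^ (d+1)) * G = Polynomial.C (s^d) * G' +
        Polynomial.C (s^d) * (Polynomial.C (s * G.coeff d) * Polynomial.X ^ d) := by
      simp only [G', map_mul, map_pow]; ring
    rw [this]
    exact add_mem h3 (Ideal.mul_mem_left _ _ hC)

theorem unif_kill {R : Type} [CommRing R] [IsNoetherianRing R] (S : Submonoid R) (I K : Ideal R)
    (h : ∀ g ∈ K, ∃ s ∈ S, s * g ∈ I) : ∃ s ∈ S, ∀ g ∈ K, s * g ∈ I := by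
  classical
  obtain ⟨G, rfl⟩ := (isNoetherianRing_iff_ideal_fg R).1 ‹_› K
  have h' : ∀ g : G, ∃ s ∈ S, s * g ∈ I := fun g => h g (Ideal.subset_span g.2)
  choose s hs hsI using h'
  refine ⟨∏ g, s g, S.prod_mem fun g _ => hs g, fun g hg => ?_⟩
  induction hg using Submodule.span_induction with
  | mem x hx =>
    obtain ⟨c, hc⟩ := Finset.dvd_prod_of_mem s (Finset.mem_univ (⟨x, hx⟩ : G))
    rw [hc, mul_right_comm]
    exact Ideal.mul_mem_right _ _ (hsI ⟨x, hx⟩)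
  | zero => simp
  | add x y _ _ hx hy => rw [mul_add]; exact add_mem hx hy
  | smul a x _ hx => rw [smul_eq_mul, mul_left_comm]; exact Ideal.mul_mem_left _ _ hx

open MvPolynomial
variable {k : Type} [Field k] {σ : Type}

/-- isolate one variable -/
noncomputable def isoE (k : Type) [Field k] {σ : Type} (y : σ) :
    MvPolynomial σ k ≃ₐ[k] Polynomial (MvPolynomial {z // z ≠ y} k) :=
  haveI := Classical.decEq σ
  (renameEquiv k (Equiv.optionSubtypeNe y).symm).trans (optionEquivLeft k _)

theorem isoE_X (y : σ) : isoE k y (X y) = Polynomial.X := by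
  classical
  simp [isoE]

theorem isoE_X' (y z : σ) (h : z ≠ y) : isoE k y (X z) = Polynomial.C (X ⟨z, h⟩) := by
  classical
  simp [isoE, Equiv.optionSubtypeNe_symm_of_ne h]

theorem isoE_rename (y : σ) (a : MvPolynomial {z // z ≠ y} k) :
    isoE k y (rename Subtype.val a) = Polynomial.C a := by
  have : (isoE k y).toAlgHom.comp (rename (Subtype.val : {z // z ≠ y} → σ)) =
      (IsScalarTower.toAlgHom k (MvPolynomial {z // z ≠ y} k) (Polynomial (MvPolynomial {z // z ≠ y} k))) := by
    ext i : 1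
    simp [isoE_X' y i.1 i.2]
  exact DFunLike.congr_fun this a

theorem isoE_coeff (y : σ) (T : Set σ) (f : MvPolynomial σ k)
    (hf : f ∈ supported k (insert y T)) (i : ℕ) :
    rename Subtype.val ((isoE k y f).coeff i) ∈ supported k T := by
  revert i
  induction hf using Algebra.adjoin_induction with
  | mem x hx =>
    obtain ⟨z, hz, rfl⟩ := hx
    intro i
    by_cases hzy : z = y
    · subst hzy
      rw [isoE_X, Polynomial.coeff_X]
      split_ifs
      · rw [map_one]; exact one_mem _
      · rw [map_zero]; exact zero_mem _
    · rw [isoE_X' y z hzy, Polynomial.coeff_C]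
      split_ifs
      · rw [rename_X]
        exact Algebra.subset_adjoin ⟨z, hz.resolve_left hzy, rfl⟩
      · rw [map_zero]; exact zero_mem _
  | algebraMap r =>
    intro i
    rw [AlgEquiv.commutes, Polynomial.algebraMap_apply, Polynomial.coeff_C]
    split_ifs
    · rw [AlgHom.commutes]; exact Subalgebra.algebraMap_mem _ _
    · rw [map_zero]; exact zero_mem _
  | add f g _ _ hf hg =>
    intro i
    rw [map_add, Polynomial.coeff_add, map_add]; exact add_mem (hf i) (hg i)
  | mul f g _ _ hf hg =>
    intro i
    rw [map_mul, Polynomial.coeff_mul, map_sum]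
    refine sum_mem fun x _ => ?_
    rw [map_mul]; exact mul_mem (hf _) (hg _)

theorem lemQR (y : σ) (T U : Set σ) (hyU : y ∉ U) (f : MvPolynomial σ k)
    (hf : f ∈ SV k (insert y T)) (G : Set (MvPolynomial σ k)) (hG : ∀ g ∈ G, g ∈ supported k U)
    (g : MvPolynomial σ k) (hg : f * g ∈ Ideal.span G) : ∃ s ∈ SV k T, s * g ∈ Ideal.span G := by
  have hG' : ∀ g ∈ G, ∃ b : MvPolynomial {z // z ≠ y} k, rename Subtype.val b = g := by
    intro g hg
    have hsub : U ⊆ {z | z ≠ y} := by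
      intro z hz h
      subst h
      exact hyU hz
    have : g ∈ supported k {z | z ≠ y} := supported_mono hsub (hG g hg)
    rw [supported_eq_range_rename] at this
    exact this
  let r : MvPolynomial {z // z ≠ y} k → MvPolynomial σ k := rename Subtype.val
  let J := Ideal.span (r ⁻¹' G)
  have hJ : (Ideal.span G).map (isoE k y : MvPolynomial σ k →+* _) = J.map Polynomial.C := by
    rw [Ideal.map_span, Ideal.map_span]
    congr 1
    ext x
    constructor
    · rintro ⟨g, hg, rfl⟩
      obtain ⟨b, rfl⟩ := hG' g hg
      exact ⟨b, hg, (isoE_rename y b).symm⟩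
    · rintro ⟨b, hb, rfl⟩
      exact ⟨r b, hb, isoE_rename y b⟩
  have hmem : ∀ x, x ∈ Ideal.span G ↔ isoE k y x ∈ J.map Polynomial.C := by
    intro x
    rw [← hJ]
    constructor
    · exact fun h => Ideal.mem_map_of_mem _ h
    · intro h
      obtain ⟨x', hx', h⟩ := (Ideal.mem_map_iff_of_surjective _ (isoE k y).surjective).1 h
      rwa [← (isoE k y).injective h]
  set F := isoE k y f with hF
  obtain ⟨d, hd⟩ : ∃ d : ℕ, (isoE k y g).degree < d := ⟨(isoE k y g).natDegree + 1,
    lt_of_le_of_lt Polynomial.degree_le_natDegree (by exact_mod_cast Nat.lt_succ_self _)⟩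
  have h1 := poly_qr J F d _ hd (by rw [hF, ← map_mul, ← hmem]; exact hg)
  refine ⟨(r F.leadingCoeff) ^ d, ?_, ?_⟩
  · refine Submonoid.pow_mem _ ?_ d
    refine ⟨?_, isoE_coeff y T f hf.2 _⟩
    intro h
    rw [map_eq_zero_iff _ (rename_injective _ Subtype.val_injective), Polynomial.leadingCoeff_eq_zero,
      hF, map_eq_zero_iff _ (isoE k y).injective] at h
    exact hf.1 h
  · rw [hmem, map_mul, map_pow]
    rw [show isoE k y (r F.leadingCoeff) = Polynomial.C F.leadingCoeff from isoE_rename y _, ← map_pow]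
    exact h1

end QR

section Step
variable {R : Type} [CommRing R] {N V W : Type} [AddCommGroup N] [Module R N]
  [AddCommGroup V] [Module R V] [AddCommGroup W] [Module R W]

theorem stepD (S : Submonoid R) (f : R) (g : V →ₗ[R] W) (hg : Function.Surjective g)
    (hex : Function.Exact (f • (LinearMap.id : V →ₗ[R] V)) g)
    (t : R) (ht : t ∈ S) (hK : ∀ v : V, f • v = 0 → t • v = 0) (hN : ∀ a : N, f • a = 0) (i : ℕ)
    (hi : ∀ j, i = j + 1 → SK S (EX R j N W)) : SK S (EX R i N V) := by
  let φ : V →ₗ[R] V := f • LinearMap.id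
  let K := LinearMap.ker φ
  let B := LinearMap.range φ
  have e1 : Function.Exact K.subtype φ.rangeRestrict := by
    intro x
    constructor
    · intro hx
      have : φ x = 0 := congrArg Subtype.val hx
      exact ⟨⟨x, this⟩, rfl⟩
    · rintro ⟨x, rfl⟩
      exact Subtype.ext x.2
  have s1 : (mkS _ _ e1).ShortExact :=
    mkS_shortExact _ _ e1 K.subtype_injective φ.surjective_rangeRestrict
  have e2 : Function.Exact B.subtype g := by
    intro x
    rw [hex x]
    constructor
    · rintro ⟨v, hv⟩
      exact ⟨⟨x, v, hv⟩, rfl⟩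
    · rintro ⟨⟨x, v, hv⟩, rfl⟩
      exact ⟨v, hv⟩
  have s2 : (mkS _ _ e2).ShortExact := mkS_shortExact _ _ e2 B.subtype_injective hg
  have key : ∃ s ∈ S, ∀ x : EX R i N B, exPost i N B.subtype x = 0 → s • x = 0 := by
    cases i with
    | zero =>
      refine ⟨1, S.one_mem, fun x hx => ?_⟩
      rw [one_smul]
      exact exPost_inj0 B.subtype B.subtype_injective (by rw [hx, map_zero])
    | succ j =>
      obtain ⟨s, hs, h⟩ := hi j rfl
      refine ⟨s, hs, fun x hx => ?_⟩
      obtain ⟨y, rfl⟩ := (les_post₁ s2 j x).1 hx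
      rw [← map_smul, h, map_zero]
  obtain ⟨s, hs, key⟩ := key
  refine ⟨t * s, S.mul_mem ht hs, fun x => ?_⟩
  have h1 : s • exPost i N φ.rangeRestrict x = 0 := by
    apply key
    rw [exPost_comp]
    have : B.subtype ∘ₗ φ.rangeRestrict = f • LinearMap.id := rfl
    rw [this, exPost_smul, exPost_id]
    exact ex_smul_of_left f hN i x
  rw [← map_smul] at h1
  obtain ⟨y, hy⟩ := (les_post₂ s1 i _).1 h1
  rw [mul_smul, ← hy, ← map_smul, ex_smul_of_right t ?_ i y, map_zero]
  intro a
  exact Subtype.ext (hK a.1 a.2)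

open MvPolynomial
variable {k : Type} [Field k] {σ : Type} [Finite σ]

theorem lemD_aux (T : Set σ) (N : Type) [AddCommGroup N] [Module (MvPolynomial σ k) N]
    (f : σ → MvPolynomial σ k) (Z : Finset σ) : ∀ (W : Set σ),
    Disjoint W (Z : Set σ) → (∀ z ∈ Z, z ∉ T) →
    (∀ z ∈ W, f z ∈ SV k (insert z T)) →
    (∀ z ∈ Z, f z ∈ SV k (insert z T)) → (∀ z ∈ Z, ∀ a : N, f z • a = 0) → ∀ i < Z.card,
    SK (SV k T) (EX (MvPolynomial σ k) i N (MvPolynomial σ k ⧸ Ideal.span (f '' W))) := by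
  classical
  induction Z using Finset.induction_on with
  | empty => intro W _ _ _ _ _ i hi; simp at hi
  | insert y Z hy ih =>
    intro W hd hT hW hZ hN i hi
    rw [Finset.card_insert_of_notMem hy] at hi
    have hyW : y ∉ W := fun h => Set.disjoint_left.1 hd h (by simp)
    have ih' := ih (insert y W) (by
        rw [Set.disjoint_left]
        rintro z (rfl | hz) hz'
        · exact hy hz'
        · exact Set.disjoint_left.1 hd hz (by simpa using Or.inr hz'))
      (fun z hz => hT z (Finset.mem_insert_of_mem hz))
      (by
        rintro z (rfl | hz)
        · exact hZ _ (Finset.mem_insert_self _ _)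
        · exact hW z hz)
      (fun z hz => hZ z (Finset.mem_insert_of_mem hz))
      (fun z hz => hN z (Finset.mem_insert_of_mem hz))
    let I := Ideal.span (f '' W)
    let I' := Ideal.span (f '' (insert y W))
    have hII : I ≤ I' := Ideal.span_mono (Set.image_mono (Set.subset_insert _ _))
    obtain ⟨t, ht, hK⟩ := unif_kill (SV k T) I (Submodule.comap (LinearMap.mulLeft _ (f y) : MvPolynomial σ k →ₗ[MvPolynomial σ k] _) I) (by
      intro g hg
      refine lemQR y T (T ∪ W) ?_ (f y) (hZ y (Finset.mem_insert_self _ _)) _ ?_ g hg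
      · rintro (h | h)
        · exact hT y (Finset.mem_insert_self _ _) h
        · exact hyW h
      · rintro _ ⟨z, hz, rfl⟩
        refine supported_mono ?_ (hW z hz).2
        rintro x (rfl | hx)
        · exact Or.inr hz
        · exact Or.inl hx)
    refine stepD (SV k T) (f y) (Submodule.factor hII) (Submodule.factor_surjective hII) ?_ t ht ?_
      (hN y (Finset.mem_insert_self _ _)) i (fun j hj => ih' j (by omega))
    · intro v
      obtain ⟨v, rfl⟩ := Submodule.Quotient.mk_surjective _ v
      constructor
      · intro h
        have h : v ∈ I' := (Submodule.Quotient.mk_eq_zero _).1 h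
        rw [show I' = Ideal.span {f y} ⊔ I by
          simp only [I', I, Set.image_insert_eq]; exact Ideal.span_insert _ _] at h
        obtain ⟨a, ha, b, hb, rfl⟩ := Submodule.mem_sup.1 h
        obtain ⟨c, rfl⟩ := Ideal.mem_span_singleton'.1 ha
        refine ⟨Submodule.Quotient.mk c, ?_⟩
        change f y • (Submodule.Quotient.mk c : _ ⧸ I) = _
        rw [← Submodule.Quotient.mk_smul, Submodule.Quotient.eq]
        have : f y • c - (c * f y + b) = - b := by rw [smul_eq_mul]; ring
        rw [this]
        exact neg_mem hb
      · rintro ⟨w, hw⟩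
        obtain ⟨w, rfl⟩ := Submodule.Quotient.mk_surjective _ w
        change f y • (Submodule.Quotient.mk w : _ ⧸ I) = _ at hw
        rw [← hw, map_smul]
        change f y • (Submodule.Quotient.mk w : _ ⧸ I') = _
        rw [← Submodule.Quotient.mk_smul, Submodule.Quotient.mk_eq_zero, smul_eq_mul]
        exact Ideal.mul_mem_right _ _ (Ideal.subset_span ⟨y, Set.mem_insert _ _, rfl⟩)
    · intro v hv
      obtain ⟨v, rfl⟩ := Submodule.Quotient.mk_surjective _ v
      rw [← Submodule.Quotient.mk_smul, Submodule.Quotient.mk_eq_zero] at hv ⊢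
      exact hK v hv

theorem lemD (T : Set σ) (N : Type) [AddCommGroup N] [Module (MvPolynomial σ k) N]
    (hN : ∀ z ∉ T, ∃ f ∈ SV k (insert z T), ∀ a : N, f • a = 0) (i : ℕ) (hi : i < Tᶜ.ncard) :
    SK (SV k T) (EX (MvPolynomial σ k) i N (MvPolynomial σ k)) := by
  classical
  haveI := Fintype.ofFinite σ
  choose! f hf hfN using hN
  have := lemD_aux T N f (Tᶜ : Set σ).toFinset ∅ (by simp) (by simp) (by simp) (by simpa using hf)
    (by simpa using hfN) i (by rwa [← Set.ncard_eq_toFinset_card'])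
  let e : (MvPolynomial σ k ⧸ Ideal.span (f '' ∅)) ≃ₗ[MvPolynomial σ k] MvPolynomial σ k :=
    Submodule.quotEquivOfEqBot _ (by simp)
  exact SK.surj (exPost_bij (X := N) i e).2 this

theorem SV_empty (s : MvPolynomial σ k) (hs : s ∈ SV k (∅ : Set σ)) : IsUnit s := by
  obtain ⟨h0, h⟩ := hs
  rw [supported_empty, Algebra.mem_bot] at h
  obtain ⟨c, rfl⟩ := h
  exact (IsUnit.mk0 c (by rintro rfl; simp at h0)).map (algebraMap k _)

theorem lemC (N : Type) [AddCommGroup N] [Module (MvPolynomial σ k) N]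
    (hN : ∃ t : ℕ, ∀ z : σ, ∀ a : N, (X z ^ t : MvPolynomial σ k) • a = 0) (i : ℕ) (hi : i < Nat.card σ)
    (x : EX (MvPolynomial σ k) i N (MvPolynomial σ k)) : x = 0 := by
  obtain ⟨t, ht⟩ := hN
  obtain ⟨s, hs, h⟩ := lemD (k := k) (∅ : Set σ) N (fun z _ => ⟨X z ^ t, ⟨pow_ne_zero _ (X_ne_zero z),
    pow_mem (X_mem_supported.2 (by simp)) _⟩, ht z⟩) i (by simpa [Set.ncard_univ] using hi)
  exact (SV_empty s hs).smul_eq_zero.1 (h x)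

end Step

section LAss
open MvPolynomial
variable {k : Type} [Field k] {σ : Type} [Finite σ]

theorem lemL5_aux (p : Ideal (MvPolynomial σ k)) (T : Set σ)
    (hall : ∀ i, SK (SV k T) (EX (MvPolynomial σ k) i (MvPolynomial σ k ⧸ p) (MvPolynomial σ k)))
    (j : ℕ) : ∀ (V : Type) [AddCommGroup V] [Module (MvPolynomial σ k) V]
      [Module.Finite (MvPolynomial σ k) V] (i : ℕ), Tᶜ.ncard < i + j →
      SK (SV k T) (EX (MvPolynomial σ k) i (MvPolynomial σ k ⧸ p) V) := by
  induction j with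
  | zero => intro V _ _ _ i hi; exact lemSV T _ V i hi
  | succ j ih =>
    intro V _ _ _ i hi
    obtain ⟨m, π, hπ⟩ := Module.Finite.exists_fin' (MvPolynomial σ k) V
    have e : Function.Exact (LinearMap.ker π).subtype π := LinearMap.exact_subtype_ker_map π
    have s : (mkS _ _ e).ShortExact := mkS_shortExact _ _ e (Submodule.subtype_injective _) hπ
    exact SK.mid (les_post₃ s i) (SK.pi i m (hall i)) (ih _ (i+1) (by omega))

theorem lemL5 (p : Ideal (MvPolynomial σ k)) (hp1 : p ≠ ⊤) (T : Set σ) (hT : ∀ s ∈ SV k T, s ∉ p)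
    (hmax : ∀ y ∉ T, ∃ g ∈ SV k (insert y T), g ∈ p) :
    ¬ SK (SV k T) (EX (MvPolynomial σ k) Tᶜ.ncard (MvPolynomial σ k ⧸ p) (MvPolynomial σ k)) := by
  intro hcon
  have hall : ∀ i, SK (SV k T) (EX (MvPolynomial σ k) i (MvPolynomial σ k ⧸ p) (MvPolynomial σ k)) := by
    intro i
    rcases lt_trichotomy i Tᶜ.ncard with h | h | h
    · refine lemD T _ (fun z hz => ?_) i h
      obtain ⟨g, hg, hgp⟩ := hmax z hz
      refine ⟨g, hg, fun a => ?_⟩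
      obtain ⟨a, rfl⟩ := Submodule.Quotient.mk_surjective _ a
      rw [← Submodule.Quotient.mk_smul, Submodule.Quotient.mk_eq_zero, smul_eq_mul]
      exact Ideal.mul_mem_right _ _ hgp
    · rw [h]; exact hcon
    · exact lemSV T _ _ i h
  obtain ⟨s, hs, h⟩ := lemL5_aux p T hall (Tᶜ.ncard + 1) (MvPolynomial σ k ⧸ p) 0 (by omega)
  have h1 := h (ex0 _ _ LinearMap.id)
  rw [← map_smul] at h1
  have h2 : s • (LinearMap.id : (MvPolynomial σ k ⧸ p) →ₗ[MvPolynomial σ k] _) = 0 :=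
    ex0_bij.1 (by rw [h1, map_zero])
  have h3 := DFunLike.congr_fun h2 (Submodule.Quotient.mk 1)
  change s • (Submodule.Quotient.mk 1 : MvPolynomial σ k ⧸ p) = 0 at h3
  rw [← Submodule.Quotient.mk_smul, Submodule.Quotient.mk_eq_zero, smul_eq_mul, mul_one] at h3
  exact hT s hs h3

theorem exists_T (p : Ideal (MvPolynomial σ k)) (hp1 : p ≠ ⊤) :
    ∃ T : Set σ, (∀ s ∈ SV k T, s ∉ p) ∧ ∀ y ∉ T, ∃ g ∈ SV k (insert y T), g ∈ p := by
  obtain ⟨T, hT⟩ := Set.Finite.exists_maximal (s := {T : Set σ | ∀ s ∈ SV k T, s ∉ p})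
    (Set.toFinite _) ⟨∅, fun s hs hsp => hp1 (Ideal.eq_top_of_isUnit_mem _ hsp (SV_empty s hs))⟩
  refine ⟨T, hT.1, fun y hy => ?_⟩
  by_contra! hcon
  exact hy (hT.2 (show insert y T ∈ {T : Set σ | ∀ s ∈ SV k T, s ∉ p} from hcon) (Set.subset_insert y T) (Set.mem_insert y T))

theorem lemL6 (M : Type) [AddCommGroup M] [Module (MvPolynomial σ k) M]
    [Module.Finite (MvPolynomial σ k) M] (p : Ideal (MvPolynomial σ k))
    (hp : p ∈ associatedPrimes (MvPolynomial σ k) M) :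
    ∃ h : ℕ, h ≤ Nat.card σ ∧
      p ∈ associatedPrimes (MvPolynomial σ k) (EX (MvPolynomial σ k) h M (MvPolynomial σ k)) := by
  obtain ⟨hpp, ι, hι⟩ := (isAssociatedPrime_iff_exists_injective_linearMap p M).1 hp
  obtain ⟨T, hT, hmax⟩ := exists_T p hpp.ne_top
  refine ⟨Tᶜ.ncard, Set.ncard_le_card _, ?_⟩
  set h := Tᶜ.ncard with hh
  haveI : Module.Finite (MvPolynomial σ k) (EX (MvPolynomial σ k) h M (MvPolynomial σ k)) :=
    ModuleCat.finite_ext _ (ModuleCat.of _ M) (ModuleCat.of _ (MvPolynomial σ k)) h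
  apply Module.associatedPrimes.minimalPrimes_annihilator_subset_associatedPrimes
  have hg : ∀ y ∉ T, ∃ g ∈ SV k (insert y T), g ∈ Module.annihilator (MvPolynomial σ k)
      (EX (MvPolynomial σ k) h M (MvPolynomial σ k)) := by
    intro y hy
    obtain ⟨g, hg, h1⟩ := lemSV (k := k) (insert y T) M (MvPolynomial σ k) h (by
      rw [hh]
      refine Set.ncard_lt_ncard ?_ (Set.toFinite _)
      exact compl_lt_compl_iff_lt.2 (Set.ssubset_insert hy))
    exact ⟨g, hg, Module.mem_annihilator.2 h1⟩
  refine ⟨⟨hpp, ?_⟩, ?_⟩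
  · intro a ha
    by_contra hap
    obtain ⟨s, hs, hsa⟩ := lemAlg p T hT hmax a hap
    have e : Function.Exact ι (LinearMap.range ι).mkQ := LinearMap.exact_map_mkQ_range ι
    have se : (mkS _ _ e).ShortExact := mkS_shortExact _ _ e hι (Submodule.mkQ_surjective _)
    obtain ⟨t, ht, h1⟩ := lemSV (k := k) T (M ⧸ LinearMap.range ι) (MvPolynomial σ k) (h+1) (by omega)
    refine lemL5 p hpp.ne_top T hT hmax ⟨s * t, Submonoid.mul_mem _ hs ht, fun x => ?_⟩
    have h2 : exDel' h (MvPolynomial σ k) se (t • x) = 0 := by rw [map_smul, h1]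
    obtain ⟨y, hy⟩ := (les_pre₁ se h _).1 h2
    obtain ⟨b, hb, c, hc, rfl⟩ := Submodule.mem_sup.1 hsa
    obtain ⟨c, rfl⟩ := Ideal.mem_span_singleton'.1 hc
    rw [mul_smul, add_smul]
    have h3 : b • t • x = 0 := by
      refine ex_smul_of_left b (fun a => ?_) h _
      obtain ⟨a, rfl⟩ := Submodule.Quotient.mk_surjective _ a
      rw [← Submodule.Quotient.mk_smul, Submodule.Quotient.mk_eq_zero, smul_eq_mul]
      exact Ideal.mul_mem_right _ _ hb
    have h4 : a • t • x = 0 := by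
      rw [← hy, ← map_smul, Module.mem_annihilator.1 ha, map_zero]
    rw [h3, mul_smul, h4, smul_zero, add_zero]
  · rintro q ⟨hq, hqa⟩ hqp a ha
    by_contra haq
    obtain ⟨s, hs, hsa⟩ := lemAlg q T (fun s hs hsq => hT s hs (hqp hsq))
      (fun y hy => by
        obtain ⟨g, hg, hga⟩ := hg y hy
        exact ⟨g, hg, hqa hga⟩) a haq
    refine hT s hs ((sup_le hqp ?_ : q ⊔ Ideal.span {a} ≤ p) hsa)
    rw [Ideal.span_singleton_le_iff_mem]
    exact ha

end LAss

section Dep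
variable {R : Type} [CommRing R] {N N' W : Type} [AddCommGroup N] [Module R N]
  [AddCommGroup N'] [Module R N'] [AddCommGroup W] [Module R W]

/-- depth at least `s` -/
def DG (I : Ideal R) (s : ℕ) (N : Type) [AddCommGroup N] [Module R N] : Prop :=
  ∀ j < s, ∀ x : EX R j (R ⧸ I) N, x = 0

theorem DG_equiv (I : Ideal R) (s : ℕ) (e : N ≃ₗ[R] N') (h : DG I s N) : DG I s N' := by
  intro j hj x
  obtain ⟨y, rfl⟩ := (exPost_bij (X := R ⧸ I) j e).2 x
  rw [h j hj y, map_zero]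

theorem DG_mono (I : Ideal R) {s t : ℕ} (hst : s ≤ t) (h : DG I t N) : DG I s N :=
  fun j hj => h j (by omega)

theorem le_mDepth_iff (I : Ideal R) (s : ℕ) : (s : ℕ∞) ≤ mDepth R I N ↔ DG I s N := by
  unfold mDepth
  rw [le_sInf_iff]
  constructor
  · intro h j hj x
    by_contra hx
    have : Nontrivial (extC R j (R ⧸ I) N) :=
      haveI : Nontrivial (EX R j (R ⧸ I) N) := ⟨⟨x, 0, hx⟩⟩
      (extCEquiv j (R ⧸ I) N).toEquiv.nontrivial
    have := h j ⟨j, rfl, this⟩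
    have : s ≤ j := by exact_mod_cast this
    omega
  · rintro h _ ⟨j, rfl, hj⟩
    by_contra hcon
    have hjs : j < s := by
      have := not_le.1 hcon
      exact_mod_cast this
    haveI : Nontrivial (EX R j (R ⧸ I) N) := (extCEquiv (R := R) j (R ⧸ I) N).symm.toEquiv.nontrivial
    obtain ⟨x, hx⟩ := exists_ne (0 : EX R j (R ⧸ I) N)
    exact hx (h j hjs x)

theorem DG_of_zero (I : Ideal R) (s : ℕ) (h : ∀ x : N, x = 0) : DG I s N := by
  intro j _ x
  have := ex_smul_of_right (1 : R) (fun a : N => by rw [h a, smul_zero]) j x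
  rwa [one_smul] at this

theorem DG_step (I : Ideal R) (s : ℕ) (l : R) (hl : l ∈ I) (hreg : ∀ x : N, l • x = 0 → x = 0)
    (g : N →ₗ[R] W) (hg : Function.Surjective g)
    (hex : Function.Exact (l • (LinearMap.id : N →ₗ[R] N)) g) : DG I s W ↔ DG I (s+1) N := by
  have hinj : Function.Injective (l • (LinearMap.id : N →ₗ[R] N)) := by
    rw [injective_iff_map_eq_zero]
    exact hreg
  have se : (mkS _ _ hex).ShortExact := mkS_shortExact _ _ hex hinj hg
  have hz : ∀ j (x : EX R j (R ⧸ I) N), exPost j (R ⧸ I) (l • (LinearMap.id : N →ₗ[R] N)) x = 0 := by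
    intro j x
    rw [exPost_smul, exPost_id]
    refine ex_smul_of_left l (fun a => ?_) j x
    obtain ⟨a, rfl⟩ := Submodule.Quotient.mk_surjective _ a
    rw [← Submodule.Quotient.mk_smul, Submodule.Quotient.mk_eq_zero, smul_eq_mul]
    exact Ideal.mul_mem_right _ _ hl
  constructor
  · intro h j hj x
    cases j with
    | zero => exact exPost_inj0 _ hinj (by rw [hz, map_zero])
    | succ j =>
      obtain ⟨y, rfl⟩ := (les_post₁ se j x).1 (hz _ x)
      rw [h j (by omega) y, map_zero]
  · intro h j hj x
    obtain ⟨z, rfl⟩ := (les_post₃ se j x).1 (h (j+1) (by omega) _)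
    rw [h j (by omega) z, map_zero]

theorem DG_one_notMem [IsNoetherianRing R] (I : Ideal R) (h : DG I 1 N) : I ∉ associatedPrimes R N := by
  intro hI
  obtain ⟨hpp, ι, hι⟩ := (isAssociatedPrime_iff_exists_injective_linearMap I N).1 hI
  have h1 := h 0 (by omega) (ex0 _ _ ι)
  have h2 : ι = 0 := ex0_bij.1 (by rw [h1, map_zero])
  have h3 : (Submodule.Quotient.mk 1 : R ⧸ I) = 0 := hι (by rw [h2]; rfl)
  rw [Submodule.Quotient.mk_eq_zero] at h3
  exact hpp.ne_top ((Ideal.eq_top_iff_one _).2 h3)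

theorem reg_of_ass [IsNoetherianRing R] (l : R) (h : ∀ p ∈ associatedPrimes R N, l ∉ p) (x : N)
    (hx : l • x = 0) : x = 0 := by
  by_contra hx0
  have := biUnion_associatedPrimes_eq_zero_divisors R N
  have hl : l ∈ ⋃ p ∈ associatedPrimes R N, (p : Set R) := by
    rw [this]
    exact ⟨x, hx0, hx⟩
  simp only [Set.mem_iUnion] at hl
  obtain ⟨p, hp, hlp⟩ := hl
  exact h p hp hlp

end Dep

section Fin
variable (k : Type) [Field k] (n : ℕ)

theorem satE_iff (M : Type) [AddCommGroup M] [Module (MvPolynomial (Fin n) k) M] (r : ℕ) :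
    satE k n M r ↔ ∀ i, DG (irrIdeal k n) (min r (n - i))
      (EX (MvPolynomial (Fin n) k) i M (MvPolynomial (Fin n) k)) := by
  unfold satE
  refine forall_congr' fun i => ?_
  have : min (r : ℕ∞) ((n : ℕ∞) - (i : ℕ∞)) = ((min r (n - i) : ℕ) : ℕ∞) := by
    rw [← ENat.natCast_sub]; exact ((Nat.mono_cast (α := ℕ∞)).map_min).symm
  rw [this, le_mDepth_iff]
  exact ⟨DG_equiv _ _ (extCEquiv i M _), DG_equiv _ _ (extCEquiv i M _).symm⟩

theorem satE_mono (M : Type) [AddCommGroup M] [Module (MvPolynomial (Fin n) k) M] {r s : ℕ}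
    (hrs : r ≤ s) (h : satE k n M s) : satE k n M r := by
  rw [satE_iff] at h ⊢
  exact fun i => DG_mono _ (by omega) (h i)

theorem satE_zero (M : Type) [AddCommGroup M] [Module (MvPolynomial (Fin n) k) M] :
    satE k n M 0 := by
  rw [satE_iff]
  intro i j hj
  omega

theorem le_eDepth_iff (M : Type) [AddCommGroup M] [Module (MvPolynomial (Fin n) k) M] {m : ℕ}
    (hm : m ≤ n) : (m : ℕ∞) ≤ eDepth k n M ↔ satE k n M m := by
  unfold eDepth
  rw [le_min_iff]
  constructor
  · rintro ⟨-, h⟩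
    cases m with
    | zero => exact satE_zero k n M
    | succ m =>
      have : (m : ℕ∞) < sSup {r : ℕ∞ | ∃ m : ℕ, r = (m : ℕ∞) ∧ satE k n M m} :=
        lt_of_lt_of_le (by exact_mod_cast Nat.lt_succ_self m) h
      obtain ⟨_, ⟨r, rfl, hr⟩, hmr⟩ := lt_sSup_iff.1 this
      have hmr : m < r := by exact_mod_cast hmr
      exact satE_mono k n M hmr hr
  · intro h
    exact ⟨by exact_mod_cast hm, le_sSup ⟨m, rfl, h⟩⟩

theorem eDepth_nat (M : Type) [AddCommGroup M] [Module (MvPolynomial (Fin n) k) M] :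
    ∃ e : ℕ, e ≤ n ∧ eDepth k n M = e := by
  have h : eDepth k n M ≤ n := min_le_left _ _
  obtain ⟨e, he⟩ := ENat.ne_top_iff_exists.1 (ne_top_of_le_ne_top (ENat.natCast_ne_top n) h)
  refine ⟨e, ?_, he.symm⟩
  rw [← he] at h
  exact_mod_cast h

theorem eDepth_eq (M : Type) [AddCommGroup M] [Module (MvPolynomial (Fin n) k) M] (e : ℕ)
    (he : e ≤ n) (h : satE k n M e) (h' : e < n → ¬ satE k n M (e+1)) : eDepth k n M = e := by
  obtain ⟨e', he', h1⟩ := eDepth_nat k n M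
  have h2 := (le_eDepth_iff k n M he).2 h
  rw [h1] at h2 ⊢
  have h2 : e ≤ e' := by exact_mod_cast h2
  rcases h2.eq_or_lt with rfl | h3
  · rfl
  · exact absurd ((le_eDepth_iff k n M (m := e+1) (by omega)).1 (by rw [h1]; exact_mod_cast h3)) (h' (by omega))

end Fin

section Tors
variable {R : Type} [CommRing R] {M : Type} [AddCommGroup M] [Module R M]

theorem tors_mono (I : Ideal R) : Monotone
    fun t : ℕ => Submodule.torsionBySet R M ((I ^ t : Ideal R) : Set R) := by
  intro s t hst
  exact Submodule.torsionBySet_le_torsionBySet_of_subset (Ideal.pow_le_pow_right hst)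

theorem tors_eq [IsNoetherianRing R] [Module.Finite R M] (I : Ideal R) :
    ∃ t : ℕ, tors R I M = Submodule.torsionBySet R M ((I ^ t : Ideal R) : Set R) := by
  obtain ⟨t, ht⟩ := monotone_stabilizes_iff_noetherian.2 (inferInstance : IsNoetherian R M)
    ⟨_, tors_mono (M := M) I⟩
  refine ⟨t, le_antisymm (iSup_le fun s => ?_) (le_iSup (fun t : ℕ => Submodule.torsionBySet R M ((I ^ t : Ideal R) : Set R)) t)⟩
  rcases le_total s t with h | h
  · exact tors_mono I h
  · exact (ht s h).ge

theorem notMem_ass_tors [IsNoetherianRing R] [Module.Finite R M] (I : Ideal R) :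
    I ∉ associatedPrimes R (M ⧸ tors R I M) := by
  intro hI
  obtain ⟨hpp, ι, hι⟩ := (isAssociatedPrime_iff_exists_injective_linearMap I _).1 hI
  obtain ⟨y, hy⟩ := Submodule.Quotient.mk_surjective _ (ι (Submodule.Quotient.mk 1))
  obtain ⟨t, ht⟩ := tors_eq (M := M) I
  have h1 : ∀ a ∈ I, a • y ∈ tors R I M := by
    intro a ha
    rw [← Submodule.Quotient.mk_eq_zero, Submodule.Quotient.mk_smul, hy, ← map_smul,
      ← Submodule.Quotient.mk_smul, smul_eq_mul, mul_one, (Submodule.Quotient.mk_eq_zero _).2 ha, map_zero]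
  have h2 : y ∈ tors R I M := by
    refine (le_iSup (fun t : ℕ => Submodule.torsionBySet R M ((I ^ t : Ideal R) : Set R)) (t+1)) ?_
    rw [Submodule.mem_torsionBySet_iff]
    rintro ⟨a, ha⟩
    change a • y = 0
    rw [SetLike.mem_coe, pow_succ] at ha
    induction ha using Submodule.mul_induction_on' with
    | mem_mul_mem b hb c hc =>
      have := h1 c hc
      rw [ht, Submodule.mem_torsionBySet_iff] at this
      rw [mul_smul]
      exact this ⟨b, hb⟩
    | add b _ c _ hb hc => rw [add_smul, hb, hc, add_zero]
  have h3 : (Submodule.Quotient.mk 1 : R ⧸ I) = 0 := hι (by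
    rw [← hy, (Submodule.Quotient.mk_eq_zero _).2 h2, map_zero])
  rw [Submodule.Quotient.mk_eq_zero] at h3
  exact hpp.ne_top ((Ideal.eq_top_iff_one _).2 h3)

end Tors

section Main
variable (k : Type) [Field k] (n : ℕ) (M : Type) [AddCommGroup M]
  [Module (MvPolynomial (Fin n) k) M] [Module.Finite (MvPolynomial (Fin n) k) M]

theorem tors_ext_zero (i : ℕ) (hi : i < n)
    (x : EX (MvPolynomial (Fin n) k) i (tors (MvPolynomial (Fin n) k) (irrIdeal k n) M)
      (MvPolynomial (Fin n) k)) : x = 0 := by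
  obtain ⟨t, ht⟩ := tors_eq (M := M) (irrIdeal k n)
  refine lemC _ ⟨t, fun z a => ?_⟩ i (by simpa using hi) x
  have h1 := ht.le a.2
  rw [Submodule.mem_torsionBySet_iff] at h1
  have hz : (MvPolynomial.X z : MvPolynomial (Fin n) k) ∈ irrIdeal k n :=
    Ideal.subset_span (Set.mem_range_self z)
  exact Subtype.ext (h1 ⟨MvPolynomial.X z ^ t, Ideal.pow_mem_pow hz t⟩)

theorem tors_se : (mkS (tors (MvPolynomial (Fin n) k) (irrIdeal k n) M).subtype
    (tors (MvPolynomial (Fin n) k) (irrIdeal k n) M).mkQ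
    (LinearMap.exact_subtype_mkQ _)).ShortExact :=
  mkS_shortExact _ _ _ (Submodule.subtype_injective _) (Submodule.mkQ_surjective _)

theorem pre_inj (i : ℕ) (hi : i ≤ n) : Function.Injective
    (exPre i (MvPolynomial (Fin n) k) (tors (MvPolynomial (Fin n) k) (irrIdeal k n) M).mkQ) := by
  cases i with
  | zero => exact exPre_inj0 _ (Submodule.mkQ_surjective _)
  | succ i =>
    rw [injective_iff_map_eq_zero]
    intro x hx
    obtain ⟨y, rfl⟩ := (les_pre₃ (tors_se k n M) i x).1 hx
    rw [tors_ext_zero k n M i (by omega) y, map_zero]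

theorem pre_surj (i : ℕ) (hi : i < n) : Function.Surjective
    (exPre i (MvPolynomial (Fin n) k) (tors (MvPolynomial (Fin n) k) (irrIdeal k n) M).mkQ) :=
  fun x => (les_pre₂ (tors_se k n M) i x).1 (tors_ext_zero k n M i hi _)

theorem satE_tors (r : ℕ) : satE k n M r ↔
    satE k n (M ⧸ tors (MvPolynomial (Fin n) k) (irrIdeal k n) M) r := by
  rw [satE_iff, satE_iff]
  refine forall_congr' fun i => ?_
  by_cases hi : i < n
  · let e := LinearEquiv.ofBijective _ ⟨pre_inj k n M i hi.le, pre_surj k n M i hi⟩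
    exact ⟨DG_equiv _ _ e.symm, DG_equiv _ _ e⟩
  · have : min r (n - i) = 0 := by omega
    rw [this]
    exact ⟨fun _ j hj => by omega, fun _ j hj => by omega⟩

theorem part1 : eDepth k n M =
      eDepth k n (M ⧸ tors (MvPolynomial (Fin n) k) (irrIdeal k n) M) := by
  unfold eDepth
  simp_rw [← satE_tors]

end Main

section PartTwo
variable (k : Type) [Field k] (n : ℕ) (M : Type) [AddCommGroup M]
  [Module (MvPolynomial (Fin n) k) M] [Module.Finite (MvPolynomial (Fin n) k) M]

theorem quot_reg (l : MvPolynomial (Fin n) k) (hl : IsSFRg k n l M)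
    (x : M ⧸ tors (MvPolynomial (Fin n) k) (irrIdeal k n) M) (hx : l • x = 0) : x = 0 := by
  refine reg_of_ass l (fun p hp => ?_) x hx
  have hpm : p ≠ irrIdeal k n := by
    rintro rfl
    exact notMem_ass_tors _ hp
  obtain ⟨h, hh, hp'⟩ := lemL6 _ p hp
  rw [Nat.card_eq_fintype_card, Fintype.card_fin] at hh
  have h1 := associatedPrimes.subset_of_injective (pre_inj k n M h hh) hp'
  have h2 := associatedPrimes.subset_of_injective (extCEquiv (R := MvPolynomial (Fin n) k) h M
    (MvPolynomial (Fin n) k)).symm.injective h1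
  exact hl.2.2 h p h2 hpm

theorem ext_reg (l : MvPolynomial (Fin n) k) (hl : IsSFRg k n l M) (h1 : satE k n M 1) (i : ℕ)
    (hi : i < n) (x : EX (MvPolynomial (Fin n) k) i
      (M ⧸ tors (MvPolynomial (Fin n) k) (irrIdeal k n) M) (MvPolynomial (Fin n) k))
    (hx : l • x = 0) : x = 0 := by
  refine reg_of_ass l (fun p hp => ?_) x hx
  have h2 := associatedPrimes.subset_of_injective (pre_inj k n M i hi.le) hp
  rw [satE_iff] at h1
  have h3 := h1 i
  rw [show min 1 (n - i) = 1 by omega] at h3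
  refine hl.2.2 i p (associatedPrimes.subset_of_injective (extCEquiv (R := MvPolynomial (Fin n) k) i M
    (MvPolynomial (Fin n) k)).symm.injective h2) ?_
  rintro rfl
  exact DG_one_notMem _ h3 h2

/-- the projection `M/H → M/(H + lM)` -/
noncomputable def qmap (l : MvPolynomial (Fin n) k) :
    (M ⧸ tors (MvPolynomial (Fin n) k) (irrIdeal k n) M) →ₗ[MvPolynomial (Fin n) k]
    (M ⧸ (tors (MvPolynomial (Fin n) k) (irrIdeal k n) M ⊔
          Ideal.span {l} • (⊤ : Submodule (MvPolynomial (Fin n) k) M))) :=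
  Submodule.factor le_sup_left

theorem qmap_surj (l : MvPolynomial (Fin n) k) : Function.Surjective (qmap k n M l) :=
  Submodule.factor_surjective le_sup_left

theorem qmap_exact (l : MvPolynomial (Fin n) k) : Function.Exact
    (l • (LinearMap.id : (M ⧸ tors (MvPolynomial (Fin n) k) (irrIdeal k n) M) →ₗ[MvPolynomial (Fin n) k] _))
    (qmap k n M l) := by
  intro x
  obtain ⟨v, rfl⟩ := Submodule.Quotient.mk_surjective _ x
  constructor
  · intro h
    have h := (Submodule.Quotient.mk_eq_zero _).1 h
    obtain ⟨a, ha, b, hb, rfl⟩ := Submodule.mem_sup.1 h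
    rw [Submodule.ideal_span_singleton_smul] at hb
    obtain ⟨c, -, rfl⟩ := hb
    refine ⟨Submodule.Quotient.mk c, ?_⟩
    rw [Submodule.Quotient.mk_add, (Submodule.Quotient.mk_eq_zero _).2 ha, zero_add]
    rfl
  · rintro ⟨w, hw⟩
    obtain ⟨w, rfl⟩ := Submodule.Quotient.mk_surjective _ w
    rw [← hw]
    refine (Submodule.Quotient.mk_eq_zero _).2 (Submodule.mem_sup_right ?_)
    exact Submodule.smul_mem_smul (Ideal.mem_span_singleton_self l) trivial

variable (l : MvPolynomial (Fin n) k) (hl : IsSFRg k n l M) (h1 : satE k n M 1)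

theorem ext_zero_quot (hn : 0 < n) (hl : IsSFRg k n l M) (h1 : satE k n M 1)
    (x : EX (MvPolynomial (Fin n) k) 0
      (M ⧸ (tors (MvPolynomial (Fin n) k) (irrIdeal k n) M ⊔
          Ideal.span {l} • (⊤ : Submodule (MvPolynomial (Fin n) k) M))) (MvPolynomial (Fin n) k)) :
    x = 0 := by
  apply exPre_inj0 _ (qmap_surj k n M l)
  rw [map_zero]
  apply ext_reg k n M l hl h1 0 hn
  rw [← map_smul, ex_smul_of_left l ?_ 0 x, map_zero]
  intro a
  obtain ⟨v, rfl⟩ := Submodule.Quotient.mk_surjective _ a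
  refine (Submodule.Quotient.mk_eq_zero _).2 (Submodule.mem_sup_right ?_)
  exact Submodule.smul_mem_smul (Ideal.mem_span_singleton_self l) trivial

theorem DG_quot (hl : IsSFRg k n l M) (h1 : satE k n M 1) (s i : ℕ) (hi : i + 1 < n) :
    DG (irrIdeal k n) s (EX (MvPolynomial (Fin n) k) (i+1)
      (M ⧸ (tors (MvPolynomial (Fin n) k) (irrIdeal k n) M ⊔
          Ideal.span {l} • (⊤ : Submodule (MvPolynomial (Fin n) k) M))) (MvPolynomial (Fin n) k)) ↔
    DG (irrIdeal k n) (s+1) (EX (MvPolynomial (Fin n) k) i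
      (M ⧸ tors (MvPolynomial (Fin n) k) (irrIdeal k n) M) (MvPolynomial (Fin n) k)) := by
  have hinj : Function.Injective (l • (LinearMap.id :
      (M ⧸ tors (MvPolynomial (Fin n) k) (irrIdeal k n) M) →ₗ[MvPolynomial (Fin n) k] _)) := by
    rw [injective_iff_map_eq_zero]
    exact quot_reg k n M l hl
  have se := mkS_shortExact _ _ (qmap_exact k n M l) hinj (qmap_surj k n M l)
  have hpre : ∀ j, exPre j (MvPolynomial (Fin n) k) (l • (LinearMap.id :
      (M ⧸ tors (MvPolynomial (Fin n) k) (irrIdeal k n) M) →ₗ[MvPolynomial (Fin n) k] _)) =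
      l • LinearMap.id := by
    intro j
    ext x
    rw [exPre_smul, exPre_id]
    rfl
  refine DG_step (irrIdeal k n) s l hl.2.1 (ext_reg k n M l hl h1 i (by omega))
    (exDel' i (MvPolynomial (Fin n) k) se) ?_ ?_
  · intro x
    refine (les_pre₃ se i x).1 ?_
    apply ext_reg k n M l hl h1 (i+1) hi
    have := (les_pre₂ se (i+1) (exPre (i+1) (MvPolynomial (Fin n) k) (qmap k n M l) x)).2 ⟨x, rfl⟩
    rwa [hpre] at this
  · have := les_pre₁ (Y := MvPolynomial (Fin n) k) se i
    rwa [hpre] at this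

theorem satE_quot (hl : IsSFRg k n l M) (hn : 0 < n) (h1 : satE k n M 1) (r : ℕ) :
    satE k n M (r+1) ↔ satE k n (M ⧸ (tors (MvPolynomial (Fin n) k) (irrIdeal k n) M ⊔
          Ideal.span {l} • (⊤ : Submodule (MvPolynomial (Fin n) k) M))) r := by
  have h1' := (satE_tors k n M 1).1 h1
  rw [satE_tors]
  rw [satE_iff] at h1' ⊢
  rw [satE_iff]
  constructor
  · intro h i
    cases i with
    | zero => exact DG_of_zero _ _ (ext_zero_quot k n M l hn hl h1)
    | succ i =>
      by_cases hi : i + 1 < n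
      · rw [DG_quot k n M l hl h1 _ i hi]
        exact DG_mono _ (by omega) (h i)
      · intro j hj
        omega
  · intro h i
    by_cases hi : i + 1 < n
    · have := (DG_quot k n M l hl h1 _ i hi).1 (h (i+1))
      exact DG_mono _ (by omega) this
    · exact DG_mono _ (by omega) (h1' i)

theorem part2 (hl : IsSFRg k n l M) (hpos : 0 < eDepth k n M) :
    ((eDepth k n (M ⧸ (tors (MvPolynomial (Fin n) k) (irrIdeal k n) M ⊔
          Ideal.span {l} • (⊤ : Submodule (MvPolynomial (Fin n) k) M))) = eDepth k n M ∧
        eDepth k n M = (n : ℕ∞)) ∨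
       eDepth k n (M ⧸ (tors (MvPolynomial (Fin n) k) (irrIdeal k n) M ⊔
          Ideal.span {l} • (⊤ : Submodule (MvPolynomial (Fin n) k) M))) =
         eDepth k n M - 1) := by
  obtain ⟨e, hen, he⟩ := eDepth_nat k n M
  rw [he] at hpos
  have hpos : 0 < e := by exact_mod_cast hpos
  have hE : satE k n M e := (le_eDepth_iff k n M hen).1 he.ge
  have h1 : satE k n M 1 := satE_mono k n M hpos hE
  have hn : 0 < n := by omega
  have key := satE_quot k n M l hl hn h1
  obtain ⟨d, rfl⟩ : ∃ d, e = d + 1 := ⟨e - 1, by omega⟩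
  have hd := (key d).1 hE
  rcases hen.eq_or_lt with hen | hen
  · left
    refine ⟨?_, by rw [he, hen]⟩
    rw [he, hen]
    refine eDepth_eq k n _ n le_rfl ?_ (fun h => absurd h (lt_irrefl _))
    rw [satE_iff] at hd ⊢
    intro i
    cases i with
    | zero => exact DG_of_zero _ _ (ext_zero_quot k n M l hn hl h1)
    | succ i => exact DG_mono _ (by omega) (hd (i+1))
  · right
    rw [he, eDepth_eq k n _ d (by omega) hd]
    · have := ENat.natCast_sub (d+1) 1
      simpa using this
    · intro _ h
      have := (le_eDepth_iff k n M (m := d+1+1) (by omega)).2 ((key (d+1)).2 h)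
      rw [he] at this
      have : d + 1 + 1 ≤ d + 1 := by exact_mod_cast this
      omega

end PartTwo

/-- Let `R = k[x_1, …, x_n]` (`k` infinite) and `M ≠ 0` a finitely generated
ℤ-graded `R`-module.  Then:
(1) `Edepth(M) = Edepth(M/H^0_𝔪(M))`;
(2) if `Edepth(M) > 0` and `ℓ` is a homogeneous element which is strictly filter regular for
`M`, then either `Edepth(M/(H^0_𝔪(M) + ℓM)) = Edepth(M) = n`, or
`Edepth(M/(H^0_𝔪(M) + ℓM)) = Edepth(M) - 1`. -/
theorem stmt19 (k : Type) [Field k] [Infinite k] (n : ℕ)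
    (M : Type) [AddCommGroup M] [Module (MvPolynomial (Fin n) k) M] [Module k M]
    [IsScalarTower k (MvPolynomial (Fin n) k) M] [Module.Finite (MvPolynomial (Fin n) k) M]
    [Nontrivial M]
    (𝒜 : ℤ → Submodule k M) (hinternal : DirectSum.IsInternal 𝒜)
    (hcompat : ∀ (e : ℕ) (f : MvPolynomial (Fin n) k), f.IsHomogeneous e →
      ∀ (d' : ℤ), ∀ x ∈ 𝒜 d', f • x ∈ 𝒜 (d' + (e : ℤ))) :
    eDepth k n M =
      eDepth k n (M ⧸ tors (MvPolynomial (Fin n) k) (irrIdeal k n) M) ∧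
    (∀ ℓ : MvPolynomial (Fin n) k, (∃ dl : ℕ, ℓ.IsHomogeneous dl) → IsSFRg k n ℓ M →
      0 < eDepth k n M →
      ((eDepth k n (M ⧸ (tors (MvPolynomial (Fin n) k) (irrIdeal k n) M ⊔
          Ideal.span {ℓ} • (⊤ : Submodule (MvPolynomial (Fin n) k) M))) = eDepth k n M ∧
        eDepth k n M = (n : ℕ∞)) ∨
       eDepth k n (M ⧸ (tors (MvPolynomial (Fin n) k) (irrIdeal k n) M ⊔
          Ideal.span {ℓ} • (⊤ : Submodule (MvPolynomial (Fin n) k) M))) =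
         eDepth k n M - 1)) := by
  exact ⟨part1 k n M, fun ℓ _ hl hpos => part2 k n M ℓ hl hpos⟩
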